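/- Let c₁, c₂, c₃, γ ∈ ℝ and let Ū ∈ C²(−1,1) ∩ C[−1,1] satisfy (1−x²)Ū' + 2xŪ + ½Ū² = c₁(1−x) + c₂(1+x) + c₃(1−x²) on (−1,1), Ū(0) = γ, with endpoint values u₋ := Ū(−1) < 2 and u₊ := Ū(1) > −2 and endpoint asymptotics |Ū(x) − u₋| ≤ C₀(1+x)^α on (−1,0], |Ū(x) − u₊| ≤ C₀(1−x)^α on [0,1) for some α ∈ (0,1], C₀ > 0. Fix ε ∈ (0,1/2) with 4ε > max{u₋, −u₊, 0}, and define V¹θ = e^{−a(x)}, V²θ = e^{−a(x)}∫₀ˣ e^{a(s)}ds, V³φ = ∫₀ˣ e^{−b(t)}dt, V⁴φ = 1. Then there exist δ > 0 and δ' > 0 and, for each β = (β₁,β₂,β₃,β₄) ∈ ℝ⁴ with |β| < δ, a pair Ũ(β) = (Ũθ(β), Ũφ(β)) with finite M₁-norm and M₂-norm respectively and with Ũθ(β)(0) = Ũθ(β)'(0) = Ũφ(β)(0) = Ũφ(β)'(0) = 0, such that: (i) Ũ(0) = 0 and (M₁-norm of Ũθ(β) + M₂-norm of Ũφ(β))/|β|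 → 0 as β → 0; (ii) for each such β, the pair U_θ = Ū + β₁V¹θ + β₂V²θ + Ũθ(β), U_φ = β₃V³φ + β₄ + Ũφ(β) satisfies, for some constants ĉ₁, ĉ₂, ĉ₃ ∈ ℝ, the system (1−x²)U_θ' + 2xU_θ + ½U_θ² + ∫₀ˣ∫₀ˡ∫₀ᵗ 2U_φ(s)U_φ'(s)/(1−s²) ds dt dl = ĉ₁(1−x) + ĉ₂(1+x) + ĉ₃(1−x²) and (1−x²)U_φ'' + U_θU_φ' = 0 on (−1,1); (iii) moreover any pair (U_θ, U_φ) solving this system for some constants ĉ₁, ĉ₂, ĉ₃ and satisfying M₁-norm of (U_θ − Ū) + M₂-norm of U_φ < δ' is of this form for some |β| < δ. -/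

import Mathlib

open Set Filter

/-- `a(x) = ∫₀ˣ (2s + Ū(s))/(1−s²) ds`. -/
noncomputable def aF (U : ℝ → ℝ) (x : ℝ) : ℝ := ∫ s in (0:ℝ)..x, (2*s + U s) / (1 - s^2)

/-- `b(x) = ∫₀ˣ Ū(s)/(1−s²) ds`. -/
noncomputable def bF (U : ℝ → ℝ) (x : ℝ) : ℝ := ∫ s in (0:ℝ)..x, U s / (1 - s^2)

/-- `V¹θ(x) = e^{−a(x)}`. -/
noncomputable def V1F (U : ℝ → ℝ) (x : ℝ) : ℝ := Real.exp (-(aF U x))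

/-- `V²θ(x) = e^{−a(x)} ∫₀ˣ e^{a(s)} ds`. -/
noncomputable def V2F (U : ℝ → ℝ) (x : ℝ) : ℝ :=
  Real.exp (-(aF U x)) * ∫ s in (0:ℝ)..x, Real.exp (aF U s)

/-- `V³φ(x) = ∫₀ˣ e^{−b(t)} dt`. -/
noncomputable def V3F (U : ℝ → ℝ) (x : ℝ) : ℝ := ∫ t in (0:ℝ)..x, Real.exp (-(bF U t))

theorem one_sub_sq_pos {x : ℝ} (hx : x ∈ Ioo (-1:ℝ) 1) : 0 < 1 - x^2 := by
  nlinarith [hx.1, hx.2]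

theorem uIcc_zero_subset_Ioo {x : ℝ} (hx : x ∈ Ioo (-1:ℝ) 1) : uIcc 0 x ⊆ Ioo (-1:ℝ) 1 :=
  ordConnected_Ioo.uIcc_subset (by norm_num) hx

theorem zero_mem_Ioo : (0:ℝ) ∈ Ioo (-1:ℝ) 1 := by norm_num

theorem hasDerivAt_primitive {f : ℝ → ℝ} (hf : ContinuousOn f (Ioo (-1:ℝ) 1)) {x : ℝ}
    (hx : x ∈ Ioo (-1:ℝ) 1) : HasDerivAt (fun y => ∫ s in (0:ℝ)..y, f s) (f x) x :=
  intervalIntegral.integral_hasDerivAt_right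
    ((hf.mono (uIcc_zero_subset_Ioo hx)).intervalIntegrable)
    (hf.stronglyMeasurableAtFilter isOpen_Ioo x hx)
    (hf.continuousAt (Ioo_mem_nhds hx.1 hx.2))

theorem intervalIntegrable_zero {f : ℝ → ℝ} (hf : ContinuousOn f (Ioo (-1:ℝ) 1)) {x : ℝ}
    (hx : x ∈ Ioo (-1:ℝ) 1) : IntervalIntegrable f MeasureTheory.volume 0 x :=
  (hf.mono (uIcc_zero_subset_Ioo hx)).intervalIntegrable

theorem continuousOn_primitive {f : ℝ → ℝ} (hf : ContinuousOn f (Ioo (-1:ℝ) 1)) :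
    ContinuousOn (fun y => ∫ s in (0:ℝ)..y, f s) (Ioo (-1:ℝ) 1) :=
  fun _ hx => (hasDerivAt_primitive hf hx).continuousAt.continuousWithinAt

theorem hasDerivAt_one_sub_sq_rpow (σ : ℝ) {x : ℝ} (hx : x ∈ Ioo (-1:ℝ) 1) :
    HasDerivAt (fun y : ℝ => (1 - y^2) ^ σ) (-(2 * x) * σ * (1 - x^2) ^ (σ - 1)) x := by
  have h : HasDerivAt (fun y : ℝ => 1 - y^2) (-(2*x)) x := by
    simpa using (hasDerivAt_pow 2 x).const_sub 1
  exact h.rpow_const (Or.inl (one_sub_sq_pos hx).ne')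

theorem continuousOn_one_sub_sq_rpow (σ : ℝ) :
    ContinuousOn (fun y : ℝ => (1 - y^2) ^ σ) (Ioo (-1:ℝ) 1) :=
  fun _ hx => (hasDerivAt_one_sub_sq_rpow σ hx).continuousAt.continuousWithinAt

theorem continuousOn_div_one_sub_sq {f : ℝ → ℝ} (hf : ContinuousOn f (Ioo (-1:ℝ) 1)) :
    ContinuousOn (fun y => f y / (1 - y^2)) (Ioo (-1:ℝ) 1) :=
  hf.div (by fun_prop) fun _ hx => (one_sub_sq_pos hx).ne'

theorem neg_mem_Ioo {x : ℝ} (hx : x ∈ Ioo (-1:ℝ) 1) : -x ∈ Ioo (-1:ℝ) 1 :=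
  ⟨by linarith [hx.2], by linarith [hx.1]⟩

theorem ContinuousOn.comp_neg_Ioo {f : ℝ → ℝ} (hf : ContinuousOn f (Ioo (-1:ℝ) 1)) :
    ContinuousOn (fun y => f (-y)) (Ioo (-1:ℝ) 1) :=
  hf.comp continuous_neg.continuousOn fun _ hx => neg_mem_Ioo hx

theorem integral_zero_neg (f : ℝ → ℝ) (x : ℝ) :
    ∫ s in (0:ℝ)..(-x), f s = -∫ s in (0:ℝ)..x, f (-s) := by
  rw [intervalIntegral.integral_comp_neg, neg_zero, intervalIntegral.integral_symm]

/-- A pointwise bound by a derivative integrates to a bound by the increment. -/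
theorem abs_integral_le_of_abs_le_deriv {f G g : ℝ → ℝ} (hf : ContinuousOn f (Ioo (-1:ℝ) 1))
    {x : ℝ} (h0 : 0 ≤ x) (h1 : x < 1) (hG : ∀ y ∈ Icc 0 x, HasDerivAt G (g y) y)
    (hfg : ∀ y ∈ Icc 0 x, |f y| ≤ g y) : |∫ s in (0:ℝ)..x, f s| ≤ G x - G 0 := by
  have hmem : ∀ y ∈ Icc 0 x, y ∈ Ioo (-1:ℝ) 1 := fun y hy =>
    ⟨by linarith [hy.1], by linarith [hy.2]⟩
  have hf' : ∀ y ∈ Icc 0 x, HasDerivAt (fun y => ∫ s in (0:ℝ)..y, f s) (f y) y :=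
    fun y hy => hasDerivAt_primitive hf (hmem y hy)
  have key : ∀ F F' : ℝ → ℝ, (∀ y ∈ Icc 0 x, HasDerivAt F (F' y) y) →
      (∀ y ∈ Icc 0 x, 0 ≤ F' y) → F 0 ≤ F x := by
    intro F F' hF hF'
    have : MonotoneOn F (Icc 0 x) := by
      refine monotoneOn_of_deriv_nonneg (convex_Icc 0 x)
        (fun y hy => (hF y hy).continuousAt.continuousWithinAt)
        (fun y hy => (hF y (interior_subset hy)).differentiableAt.differentiableWithinAt) ?_
      intro y hy
      rw [(hF y (interior_subset hy)).deriv]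
      exact hF' y (interior_subset hy)
    exact this ⟨le_rfl, h0⟩ ⟨h0, le_rfl⟩ h0
  have k1 := key (fun y => G y - ∫ s in (0:ℝ)..y, f s) (fun y => g y - f y)
    (fun y hy => (hG y hy).sub (hf' y hy))
    (fun y hy => by linarith [(abs_le.1 (hfg y hy)).2])
  have k2 := key (fun y => G y + ∫ s in (0:ℝ)..y, f s) (fun y => g y + f y)
    (fun y hy => (hG y hy).add (hf' y hy))
    (fun y hy => by linarith [(abs_le.1 (hfg y hy)).1])
  simp only [intervalIntegral.integral_same, sub_zero, add_zero] at k1 k2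
  rw [abs_le]; constructor <;> linarith

/-- Two-sided form of a one-sided primitive bound. -/
theorem forall_Ioo_of_nonneg {P : ℝ → Prop} (hp : ∀ x ∈ Ico (0:ℝ) 1, P x)
    (hn : ∀ x ∈ Ico (0:ℝ) 1, P (-x)) : ∀ x ∈ Ioo (-1:ℝ) 1, P x := by
  intro x hx
  rcases le_total 0 x with h | h
  · exact hp x ⟨h, hx.2⟩
  · simpa using hn (-x) ⟨by linarith, by linarith [hx.1]⟩

theorem exists_integral_le_weight_right {E U : ℝ → ℝ} {s : ℝ}
    (hE : ∀ x ∈ Ioo (-1:ℝ) 1, 0 < E x)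
    (hE' : ∀ x ∈ Ioo (-1:ℝ) 1, HasDerivAt E (E x * U x / (1 - x^2)) x)
    (hU : ContinuousOn U (Icc (-1:ℝ) 1)) (h1 : -(U 1) < 2 * s) :
    ∃ C : ℝ, 0 < C ∧ ∀ x ∈ Ico (0:ℝ) 1,
      1 ≤ C * (E x * (1 - x^2) ^ (-s)) ∧
      ∀ f : ℝ → ℝ, ContinuousOn f (Ioo (-1:ℝ) 1) → ∀ K : ℝ,
        (∀ y ∈ Ico (0:ℝ) 1, |f y| ≤ K * (E y * (1 - y^2) ^ (-s - 1))) →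
        |∫ t in (0:ℝ)..x, f t| ≤ C * K * (E x * (1 - x^2) ^ (-s)) := by
  obtain ⟨c, hc, hc1⟩ : ∃ c, 0 < c ∧ c < U 1 + 2 * s := ⟨(U 1 + 2*s)/2, by linarith, by linarith⟩
  have hev : ∀ᶠ x in nhdsWithin 1 (Icc (-1:ℝ) 1), c < U x + 2 * s * x := by
    have : ContinuousWithinAt (fun x => U x + 2 * s * x) (Icc (-1:ℝ) 1) 1 :=
      (hU 1 (by norm_num)).add (by fun_prop)
    exact this.eventually (lt_mem_nhds (by simpa using hc1))
  obtain ⟨x₀, hx₀, hx₀'⟩ : ∃ x₀ ∈ Ico (0:ℝ) 1, ∀ x ∈ Ico x₀ 1, c ≤ U x + 2 * s * x := by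
    rw [eventually_nhdsWithin_iff, Metric.eventually_nhds_iff] at hev
    obtain ⟨η, hη, h⟩ := hev
    refine ⟨max 0 (1 - η/2), ⟨le_max_left _ _, max_lt (by norm_num) (by linarith)⟩, ?_⟩
    intro x hx
    have h3 : 0 ≤ x := (le_max_left _ _).trans hx.1
    have h4 : 1 - η/2 ≤ x := (le_max_right _ _).trans hx.1
    refine (h (y := x) ?_ ⟨by linarith, hx.2.le⟩).le
    rw [Real.dist_eq, abs_lt]; constructor <;> linarith [hx.2]
  set F : ℝ → ℝ := fun x => E x * (1 - x^2) ^ (-s) with hF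
  set k : ℝ → ℝ := fun x => E x * (1 - x^2) ^ (-s - 1) with hk
  have hFpos : ∀ x ∈ Ioo (-1:ℝ) 1, 0 < F x := fun x hx =>
    mul_pos (hE x hx) (Real.rpow_pos_of_pos (one_sub_sq_pos hx) _)
  have hkpos : ∀ x ∈ Ioo (-1:ℝ) 1, 0 < k x := fun x hx =>
    mul_pos (hE x hx) (Real.rpow_pos_of_pos (one_sub_sq_pos hx) _)
  have hF' : ∀ x ∈ Ioo (-1:ℝ) 1, HasDerivAt F (k x * (U x + 2 * s * x)) x := by
    intro x hx
    refine ((hE' x hx).mul (hasDerivAt_one_sub_sq_rpow (-s) hx)).congr_deriv ?_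
    have := one_sub_sq_pos hx
    simp only [hk]
    rw [Real.rpow_sub_one this.ne']
    field_simp
  have hIco : ∀ x ∈ Ico (0:ℝ) 1, x ∈ Ioo (-1:ℝ) 1 := fun x hx => ⟨by linarith [hx.1], hx.2⟩
  have hEc : ContinuousOn E (Ioo (-1:ℝ) 1) := fun x hx =>
    (hE' x hx).continuousAt.continuousWithinAt
  have hFc : ContinuousOn F (Ioo (-1:ℝ) 1) := hEc.mul (continuousOn_one_sub_sq_rpow _)
  have hkc : ContinuousOn k (Ioo (-1:ℝ) 1) := hEc.mul (continuousOn_one_sub_sq_rpow _)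
  have hsub : Icc 0 x₀ ⊆ Ioo (-1:ℝ) 1 := fun y hy =>
    ⟨by linarith [hy.1], by linarith [hy.2, hx₀.2]⟩
  have hne : (Icc 0 x₀).Nonempty := ⟨0, le_rfl, hx₀.1⟩
  -- lower bound for `F`
  obtain ⟨y₀, hy₀, hmin⟩ := isCompact_Icc.exists_isMinOn hne (hFc.mono hsub)
  have hFlow : ∀ x ∈ Ico (0:ℝ) 1, F y₀ ≤ F x := by
    intro x hx
    rcases le_total x x₀ with h | h
    · exact hmin ⟨hx.1, h⟩
    · have hmono : MonotoneOn F (Ico x₀ 1) := by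
        have hm : ∀ y ∈ Ico x₀ 1, y ∈ Ioo (-1:ℝ) 1 := fun y hy =>
          ⟨by linarith [hy.1, hx₀.1], hy.2⟩
        refine monotoneOn_of_deriv_nonneg (convex_Ico x₀ 1) (hFc.mono hm)
          (fun y hy => (hF' y (hm y (interior_subset hy))).differentiableAt.differentiableWithinAt)
          ?_
        intro y hy
        have hy := interior_subset hy
        rw [(hF' y (hm y hy)).deriv]
        exact mul_nonneg (hkpos y (hm y hy)).le (hc.le.trans (hx₀' y hy))
      exact (hmin ⟨hx₀.1, le_rfl⟩).trans (hmono ⟨le_rfl, hx₀.2⟩ ⟨h, hx.2⟩ h)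
  obtain ⟨M, hM⟩ := isCompact_Icc.exists_bound_of_continuousOn
    (f := fun y => k y - c⁻¹ * (k y * (U y + 2 * s * y)))
    ((hkc.mono hsub).sub (continuousOn_const.mul ((hkc.mono hsub).mul
      ((hU.mono (hsub.trans Ioo_subset_Icc_self)).add (by fun_prop)))))
  have hM0 : 0 ≤ M := (norm_nonneg _).trans (hM 0 ⟨le_rfl, hx₀.1⟩)
  have hF0 := hFpos y₀ (hsub hy₀)
  refine ⟨(F y₀)⁻¹ + (c⁻¹ + M * (F y₀)⁻¹), by positivity, fun x hx => ?_⟩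
  have hFx := hFlow x hx
  have hFxpos := hFpos x (hIco x hx)
  have e1 : 1 ≤ (F y₀)⁻¹ * F x := by
    rw [inv_mul_eq_div, one_le_div hF0]; exact hFx
  refine ⟨?_, ?_⟩
  · have : 0 ≤ (c⁻¹ + M * (F y₀)⁻¹) * F x := by positivity
    change 1 ≤ _ * F x
    linarith
  · intro f hf K hK
    have hK0 : 0 ≤ K := by
      have := (abs_nonneg _).trans (hK 0 (by norm_num))
      exact nonneg_of_mul_nonneg_left this (hkpos 0 zero_mem_Ioo)
    have hb := abs_integral_le_of_abs_le_deriv (G := fun y => K * (c⁻¹ * F y + M * y))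
      (g := fun y => K * (c⁻¹ * (k y * (U y + 2 * s * y)) + M)) hf hx.1 hx.2
      (fun y hy => by
        have hy' : y ∈ Ioo (-1:ℝ) 1 := ⟨by linarith [hy.1], by linarith [hy.2, hx.2]⟩
        exact ((((hF' y hy').const_mul c⁻¹).add
          (((hasDerivAt_id y).const_mul M).congr_deriv (mul_one M))).const_mul K))
      (fun y hy => by
        have hy' : y ∈ Ico (0:ℝ) 1 := ⟨hy.1, by linarith [hy.2, hx.2]⟩
        refine (hK y hy').trans (mul_le_mul_of_nonneg_left ?_ hK0)
        change k y ≤ _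
        rcases le_total y x₀ with h | h
        · have := (abs_le.1 (hM y ⟨hy.1, h⟩)).2
          linarith
        · have h2 := hx₀' y ⟨h, hy'.2⟩
          have : k y * c ≤ k y * (U y + 2 * s * y) :=
            mul_le_mul_of_nonneg_left h2 (hkpos y (hIco y hy')).le
          have h3 : k y ≤ c⁻¹ * (k y * (U y + 2 * s * y)) := by
            rw [inv_mul_eq_div, le_div_iff₀ hc]; exact this
          linarith)
    refine hb.trans ?_
    change _ ≤ _ * F x
    have hF00 := hFpos 0 zero_mem_Ioo
    have : K * (c⁻¹ * F x + M * x) - K * (c⁻¹ * F 0 + M * 0)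
        ≤ K * (c⁻¹ * F x + M * ((F y₀)⁻¹ * F x)) := by
      rw [← mul_sub]
      refine mul_le_mul_of_nonneg_left ?_ hK0
      have a1 : M * x ≤ M * ((F y₀)⁻¹ * F x) :=
        mul_le_mul_of_nonneg_left (hx.2.le.trans e1) hM0
      have a2 : 0 < c⁻¹ * F 0 := by positivity
      linarith
    refine this.trans ?_
    have : 0 ≤ (F y₀)⁻¹ * K * F x := by positivity
    nlinarith

theorem exists_integral_le_weight {E U : ℝ → ℝ} {s : ℝ}
    (hE : ∀ x ∈ Ioo (-1:ℝ) 1, 0 < E x)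
    (hE' : ∀ x ∈ Ioo (-1:ℝ) 1, HasDerivAt E (E x * U x / (1 - x^2)) x)
    (hU : ContinuousOn U (Icc (-1:ℝ) 1)) (hm : U (-1) < 2 * s) (h1 : -(U 1) < 2 * s) :
    ∃ C : ℝ, 0 < C ∧ ∀ x ∈ Ioo (-1:ℝ) 1,
      1 ≤ C * (E x * (1 - x^2) ^ (-s)) ∧
      ∀ f : ℝ → ℝ, ContinuousOn f (Ioo (-1:ℝ) 1) → ∀ K : ℝ,
        (∀ y ∈ Ioo (-1:ℝ) 1, |f y| ≤ K * (E y * (1 - y^2) ^ (-s - 1))) →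
        |∫ t in (0:ℝ)..x, f t| ≤ C * K * (E x * (1 - x^2) ^ (-s)) := by
  obtain ⟨C₁, hC₁, H₁⟩ := exists_integral_le_weight_right hE hE' hU h1
  obtain ⟨C₂, hC₂, H₂⟩ := exists_integral_le_weight_right (E := fun x => E (-x))
    (U := fun x => -U (-x)) (s := s) (fun x hx => hE _ (neg_mem_Ioo hx))
    (fun x hx => by
      have := (hE' _ (neg_mem_Ioo hx)).scomp x (hasDerivAt_neg x)
      refine this.congr_deriv ?_
      simp only [smul_eq_mul, neg_sq]; ring)
    ((hU.comp continuous_neg.continuousOn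
      fun x hx => ⟨by linarith [hx.2], by linarith [hx.1]⟩).neg) (by simpa using hm)
  have hIco : ∀ x ∈ Ico (0:ℝ) 1, x ∈ Ioo (-1:ℝ) 1 := fun x hx => ⟨by linarith [hx.1], hx.2⟩
  have hnn : ∀ x ∈ Ioo (-1:ℝ) 1, 0 ≤ E x * (1 - x^2) ^ (-s) := fun x hx =>
    (mul_pos (hE x hx) (Real.rpow_pos_of_pos (one_sub_sq_pos hx) _)).le
  have hK0 : ∀ (f : ℝ → ℝ) (K : ℝ),
      (∀ y ∈ Ioo (-1:ℝ) 1, |f y| ≤ K * (E y * (1 - y^2) ^ (-s - 1))) → 0 ≤ K := by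
    intro f K h
    exact nonneg_of_mul_nonneg_left ((abs_nonneg _).trans (h 0 zero_mem_Ioo))
      (mul_pos (hE 0 zero_mem_Ioo) (Real.rpow_pos_of_pos (one_sub_sq_pos zero_mem_Ioo) _))
  refine ⟨C₁ + C₂, by positivity, forall_Ioo_of_nonneg (fun x hx => ⟨?_, ?_⟩)
    (fun x hx => ⟨?_, ?_⟩)⟩
  · have := mul_nonneg hC₂.le (hnn x (hIco x hx))
    linarith [(H₁ x hx).1]
  · intro f hf K hK
    have h := (H₁ x hx).2 f hf K fun y hy => hK y (hIco y hy)
    have := mul_nonneg (mul_nonneg hC₂.le (hK0 f K hK)) (hnn x (hIco x hx))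
    linarith
  · have := mul_nonneg hC₁.le (hnn (-x) (neg_mem_Ioo (hIco x hx)))
    have h2 := (H₂ x hx).1
    rw [neg_sq] at *
    linarith
  · intro f hf K hK
    have h := (H₂ x hx).2 (fun y => f (-y)) hf.comp_neg_Ioo K fun y hy => by
      simpa using hK _ (neg_mem_Ioo (hIco y hy))
    have := mul_nonneg (mul_nonneg hC₁.le (hK0 f K hK)) (hnn (-x) (neg_mem_Ioo (hIco x hx)))
    rw [integral_zero_neg, abs_neg]
    rw [neg_sq] at *
    linarith

theorem abs_integral_le_of_weight {f : ℝ → ℝ} {s K : ℝ} (hs0 : 0 ≤ s) (hs : s < 1)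
    (hf : ContinuousOn f (Ioo (-1:ℝ) 1))
    (hK : ∀ y ∈ Ioo (-1:ℝ) 1, |f y| ≤ K * (1 - y^2) ^ (-s)) :
    ∀ x ∈ Ioo (-1:ℝ) 1, |∫ t in (0:ℝ)..x, f t| ≤ K * (1 - s)⁻¹ := by
  have hK0 : 0 ≤ K := by simpa using (abs_nonneg _).trans (hK 0 zero_mem_Ioo)
  have key : ∀ f : ℝ → ℝ, ContinuousOn f (Ioo (-1:ℝ) 1) →
      (∀ y ∈ Ioo (-1:ℝ) 1, |f y| ≤ K * (1 - y^2) ^ (-s)) →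
      ∀ x ∈ Ico (0:ℝ) 1, |∫ t in (0:ℝ)..x, f t| ≤ K * (1 - s)⁻¹ := by
    intro f hf hK x hx
    have h := abs_integral_le_of_abs_le_deriv (G := fun y => -(K * (1 - s)⁻¹) * (1 - y) ^ (1 - s))
      (g := fun y => K * (1 - y) ^ (-s)) hf hx.1 hx.2 (fun y hy => by
        have hy1 : 0 < 1 - y := by linarith [hy.2, hx.2]
        have h1 : HasDerivAt (fun y : ℝ => 1 - y) (-1) y := by
          simpa using (hasDerivAt_id y).const_sub 1
        refine ((h1.rpow_const (p := 1 - s) (Or.inl hy1.ne')).const_mul _).congr_deriv ?_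
        have : 1 - s ≠ 0 := by linarith
        rw [show 1 - s - 1 = -s by ring]
        field_simp) (fun y hy => by
        have hy' : y ∈ Ioo (-1:ℝ) 1 := ⟨by linarith [hy.1], by linarith [hy.2, hx.2]⟩
        refine (hK y hy').trans (mul_le_mul_of_nonneg_left ?_ hK0)
        exact Real.rpow_le_rpow_of_nonpos (by linarith [hy'.2])
          (by nlinarith [hy.1, hy'.2]) (by linarith))
    have h2 : 0 ≤ K * (1 - s)⁻¹ * (1 - x) ^ (1 - s) := by
      have : 0 < 1 - s := by linarith
      have : 0 ≤ 1 - x := by linarith [hx.2]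
      positivity
    simp only [sub_zero, Real.one_rpow] at h
    linarith
  refine forall_Ioo_of_nonneg (key f hf hK) fun x hx => ?_
  rw [integral_zero_neg, abs_neg]
  exact key _ hf.comp_neg_Ioo (fun y hy => by simpa using hK _ (neg_mem_Ioo hy)) x hx

/-- `f` is continuous on `(-1,1)` and `|f x| ≤ K (1 - x²)^σ` there. -/
def WeightBound (σ K : ℝ) (f : ℝ → ℝ) : Prop :=
  ContinuousOn f (Ioo (-1:ℝ) 1) ∧ ∀ x ∈ Ioo (-1:ℝ) 1, |f x| ≤ K * (1 - x^2) ^ σ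

namespace WeightBound

variable {σ τ K L : ℝ} {f g : ℝ → ℝ}

theorem nonneg (hf : WeightBound σ K f) : 0 ≤ K := by
  simpa using (abs_nonneg _).trans (hf.2 0 zero_mem_Ioo)

theorem mono (hf : WeightBound σ K f) (h : K ≤ L) : WeightBound σ L f :=
  ⟨hf.1, fun x hx => (hf.2 x hx).trans
    (mul_le_mul_of_nonneg_right h (Real.rpow_nonneg (one_sub_sq_pos hx).le _))⟩

theorem weaken (hf : WeightBound σ K f) (h : τ ≤ σ) : WeightBound τ K f :=
  ⟨hf.1, fun x hx => (hf.2 x hx).trans (mul_le_mul_of_nonneg_left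
    (Real.rpow_le_rpow_of_exponent_ge (one_sub_sq_pos hx) (by nlinarith [sq_nonneg x]) h)
    hf.nonneg)⟩

theorem congr (hf : WeightBound σ K f) (h : EqOn g f (Ioo (-1:ℝ) 1)) : WeightBound σ K g :=
  ⟨hf.1.congr h, fun x hx => by rw [h hx]; exact hf.2 x hx⟩

theorem add (hf : WeightBound σ K f) (hg : WeightBound σ L g) :
    WeightBound σ (K + L) (fun x => f x + g x) :=
  ⟨hf.1.add hg.1, fun x hx => by
    have := abs_add_le (f x) (g x)
    linarith [hf.2 x hx, hg.2 x hx]⟩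

theorem neg (hf : WeightBound σ K f) : WeightBound σ K (fun x => -f x) :=
  ⟨hf.1.neg, fun x hx => by rw [abs_neg]; exact hf.2 x hx⟩

theorem sub (hf : WeightBound σ K f) (hg : WeightBound σ L g) :
    WeightBound σ (K + L) (fun x => f x - g x) := by
  simpa only [sub_eq_add_neg] using hf.add hg.neg

theorem mul (hf : WeightBound σ K f) (hg : WeightBound τ L g) :
    WeightBound (σ + τ) (K * L) (fun x => f x * g x) :=
  ⟨hf.1.mul hg.1, fun x hx => by
    rw [abs_mul, Real.rpow_add (one_sub_sq_pos hx)]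
    have := mul_le_mul (hf.2 x hx) (hg.2 x hx) (abs_nonneg _) ((abs_nonneg _).trans (hf.2 x hx))
    linarith⟩

theorem const_mul (hf : WeightBound σ K f) (c : ℝ) :
    WeightBound σ (|c| * K) (fun x => c * f x) :=
  ⟨continuousOn_const.mul hf.1, fun x hx => by
    rw [abs_mul, mul_assoc]
    exact mul_le_mul_of_nonneg_left (hf.2 x hx) (abs_nonneg _)⟩

theorem const (c : ℝ) : WeightBound 0 |c| (fun _ => c) :=
  ⟨continuousOn_const, fun x _ => by simp⟩

theorem div (hf : WeightBound σ K f) : WeightBound (σ - 1) K (fun x => f x / (1 - x^2)) :=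
  ⟨continuousOn_div_one_sub_sq hf.1, fun x hx => by
    have h := one_sub_sq_pos hx
    rw [abs_div, abs_of_pos h, Real.rpow_sub_one h.ne', ← mul_div_assoc]
    exact div_le_div_of_nonneg_right (hf.2 x hx) h.le⟩

theorem primitive {s : ℝ} (hs0 : 0 ≤ s) (hs : s < 1) (hf : WeightBound (-s) K f) :
    WeightBound 0 (K * (1 - s)⁻¹) (fun x => ∫ t in (0:ℝ)..x, f t) :=
  ⟨continuousOn_primitive hf.1, fun x hx => by
    simpa using abs_integral_le_of_weight hs0 hs hf.1 hf.2 x hx⟩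

end WeightBound

theorem exists_primitive_bound_singular {s : ℝ} (hs : 0 < s) :
    ∃ C : ℝ, 0 < C ∧ ∀ (f : ℝ → ℝ) (K : ℝ), WeightBound (-s - 1) K f →
      WeightBound (-s) (C * K) (fun x => ∫ t in (0:ℝ)..x, f t) := by
  obtain ⟨C, hC, H⟩ := exists_integral_le_weight (E := fun _ => 1) (U := fun _ => 0) (s := s)
    (fun _ _ => one_pos) (fun x _ => by simpa using hasDerivAt_const x (1:ℝ)) continuousOn_const
    (by simpa using hs) (by simpa using hs)
  refine ⟨C, hC, fun f K hf => ⟨continuousOn_primitive hf.1, fun x hx => ?_⟩⟩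
  simpa using (H x hx).2 f hf.1 K fun y hy => by simpa using hf.2 y hy

theorem uIoo_subset_unit {x y : ℝ} (hx : x ∈ Icc (-1:ℝ) 1) (hy : y ∈ Icc (-1:ℝ) 1) :
    uIoo x y ⊆ Ioo (-1:ℝ) 1 := fun _ h =>
  ⟨(le_inf hx.1 hy.1).trans_lt h.1, h.2.trans_le (sup_le hx.2 hy.2)⟩

theorem intervalIntegrable_of_bounded {g : ℝ → ℝ} {M : ℝ} (hg : WeightBound 0 M g) {x y : ℝ}
    (hx : x ∈ Icc (-1:ℝ) 1) (hy : y ∈ Icc (-1:ℝ) 1) :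
    IntervalIntegrable g MeasureTheory.volume x y := by
  have h : IntervalIntegrable g MeasureTheory.volume (-1) 1 := by
    rw [intervalIntegrable_iff_integrableOn_Ioo_of_le (by norm_num)]
    refine MeasureTheory.IntegrableOn.of_bound (by simp)
      (hg.1.aestronglyMeasurable measurableSet_Ioo) M ?_
    filter_upwards [MeasureTheory.ae_restrict_mem measurableSet_Ioo] with z hz
    simpa using hg.2 z hz
  refine h.mono_set ?_
  rw [uIcc_of_le (show (-1:ℝ) ≤ 1 by norm_num)]
  exact uIcc_subset_Icc hx hy

theorem abs_integral_sub_le {g : ℝ → ℝ} {M : ℝ} (hg : WeightBound 0 M g) {x y : ℝ}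
    (hx : x ∈ Icc (-1:ℝ) 1) (hy : y ∈ Icc (-1:ℝ) 1) :
    |(∫ t in (0:ℝ)..x, g t) - ∫ t in (0:ℝ)..y, g t| ≤ M * |x - y| := by
  have h0 : (0:ℝ) ∈ Icc (-1:ℝ) 1 := by norm_num
  rw [intervalIntegral.integral_interval_sub_left (intervalIntegrable_of_bounded hg h0 hx)
    (intervalIntegrable_of_bounded hg h0 hy), ← Real.norm_eq_abs, ← Real.norm_eq_abs]
  refine intervalIntegral.norm_integral_le_of_norm_le_const_ae ?_
  filter_upwards [MeasureTheory.Measure.ae_ne MeasureTheory.volume (y ⊔ x)] with z hz hz'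
  simpa using hg.2 z (uIoo_subset_unit hy hx ⟨hz'.1, lt_of_le_of_ne hz'.2 hz⟩)

/-- First primitive of the swirl source `F / (1 - s²)`. -/
noncomputable def swirlInt₁ (F : ℝ → ℝ) (t : ℝ) : ℝ := ∫ s in (0:ℝ)..t, F s / (1 - s^2)

/-- Second primitive of the swirl source. -/
noncomputable def swirlInt₂ (F : ℝ → ℝ) (l : ℝ) : ℝ := ∫ t in (0:ℝ)..l, swirlInt₁ F t

/-- Third primitive of the swirl source. -/
noncomputable def swirlInt (F : ℝ → ℝ) (x : ℝ) : ℝ := ∫ l in (0:ℝ)..x, swirlInt₂ F l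

/-- The triple primitive, subtracted from the affine function with the same endpoint values,
divided by `1 - x²` and normalized to vanish at the origin. -/
noncomputable def swirlSource (F : ℝ → ℝ) (x : ℝ) : ℝ :=
  (swirlInt F (-1) * (1 - x) / 2 + swirlInt F 1 * (1 + x) / 2 - swirlInt F x) / (1 - x^2)
    - (swirlInt F (-1) + swirlInt F 1) / 2

theorem swirlInt_congr {F G : ℝ → ℝ} (h : EqOn F G (Ioo (-1:ℝ) 1)) {x : ℝ}
    (hx : x ∈ Ioo (-1:ℝ) 1) : swirlInt F x = swirlInt G x := by
  refine intervalIntegral.integral_congr fun l hl => intervalIntegral.integral_congr fun t ht =>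
    intervalIntegral.integral_congr fun s hs => ?_
  have hl := uIcc_zero_subset_Ioo hx hl
  have ht := uIcc_zero_subset_Ioo hl ht
  simp only [h (uIcc_zero_subset_Ioo ht hs)]

theorem swirlSource_zero (F : ℝ → ℝ) : swirlSource F 0 = 0 := by
  simp [swirlSource, swirlInt]; ring

theorem exists_swirlInt_bound {s : ℝ} (hs : 0 < s) (hs1 : s < 1) :
    ∃ C : ℝ, 0 < C ∧ ∀ (F : ℝ → ℝ) (K : ℝ), WeightBound (-s) K F →
      WeightBound (-s) (C * K) (swirlInt₁ F) ∧ WeightBound 0 (C * K) (swirlInt₂ F) := by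
  obtain ⟨C, hC, H⟩ := exists_primitive_bound_singular hs
  have h1 : 0 < (1 - s)⁻¹ := by have : 0 < 1 - s := by linarith
                                positivity
  refine ⟨C + C * (1 - s)⁻¹, by positivity, fun F K hF => ?_⟩
  have h2 := H _ K hF.div
  have h3 := h2.primitive hs.le hs1
  have hK := hF.nonneg
  have e1 : 0 ≤ C * K := by positivity
  have e2 : 0 ≤ C * (1 - s)⁻¹ * K := by positivity
  exact ⟨h2.mono (by linarith), h3.mono (by linarith)⟩

theorem hasDerivAt_swirlInt {s K : ℝ} (hs : 0 < s) (hs1 : s < 1) {F : ℝ → ℝ}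
    (hF : WeightBound (-s) K F) {x : ℝ} (hx : x ∈ Ioo (-1:ℝ) 1) :
    HasDerivAt (swirlInt₁ F) (F x / (1 - x^2)) x ∧
    HasDerivAt (swirlInt₂ F) (swirlInt₁ F x) x ∧ HasDerivAt (swirlInt F) (swirlInt₂ F x) x := by
  obtain ⟨C, _, H⟩ := exists_swirlInt_bound hs hs1
  obtain ⟨h1, h2⟩ := H F K hF
  exact ⟨hasDerivAt_primitive hF.div.1 hx, hasDerivAt_primitive h1.1 hx,
    hasDerivAt_primitive h2.1 hx⟩

theorem exists_swirlSource_bound {s : ℝ} (hs : 0 < s) (hs1 : s < 1) :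
    ∃ C : ℝ, 0 < C ∧ ∀ (F : ℝ → ℝ) (K : ℝ), WeightBound (-s) K F →
      WeightBound (-s) (C * K) (swirlInt₁ F) ∧ WeightBound 0 (C * K) (swirlInt₂ F) ∧
      (∀ x ∈ Icc (-1:ℝ) 1, ∀ y ∈ Icc (-1:ℝ) 1,
        |swirlInt F x - swirlInt F y| ≤ C * K * |x - y|) ∧
      (∀ x ∈ Icc (-1:ℝ) 1, |swirlInt F x| ≤ C * K) ∧
      WeightBound 0 (C * K) (swirlSource F) := by
  obtain ⟨C, hC, H⟩ := exists_swirlInt_bound hs hs1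
  refine ⟨2 * C, by positivity, fun F K hF => ?_⟩
  obtain ⟨h1, h2⟩ := H F K hF
  have hK : 0 ≤ C * K := mul_nonneg hC.le hF.nonneg
  have hle : C * K ≤ 2 * C * K := by linarith
  have hlip : ∀ x ∈ Icc (-1:ℝ) 1, ∀ y ∈ Icc (-1:ℝ) 1,
      |swirlInt F x - swirlInt F y| ≤ C * K * |x - y| := fun x hx y hy =>
    abs_integral_sub_le h2 hx hy
  have hbd : ∀ x ∈ Icc (-1:ℝ) 1, |swirlInt F x| ≤ C * K := by
    intro x hx
    have h := hlip x hx 0 (by norm_num)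
    have h0 : swirlInt F 0 = 0 := by simp [swirlInt]
    rw [h0, sub_zero, sub_zero] at h
    exact h.trans (mul_le_of_le_one_right hK (abs_le.2 hx))
  have hm : (-1:ℝ) ∈ Icc (-1:ℝ) 1 := by norm_num
  have hp : (1:ℝ) ∈ Icc (-1:ℝ) 1 := by norm_num
  refine ⟨h1.mono hle, h2.mono hle, fun x hx y hy => (hlip x hx y hy).trans
    (mul_le_mul_of_nonneg_right hle (abs_nonneg _)), fun x hx => (hbd x hx).trans hle, ?_, ?_⟩
  · refine ContinuousOn.sub (continuousOn_div_one_sub_sq (ContinuousOn.sub ?_ ?_))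
      continuousOn_const
    · fun_prop
    · exact continuousOn_primitive h2.1
  · intro x hx
    have hx' := Ioo_subset_Icc_self hx
    have hpos := one_sub_sq_pos hx
    have e1 := hlip _ hm x hx'
    have e2 := hlip _ hp x hx'
    rw [abs_of_nonpos (a := -1 - x) (by linarith [hx.1])] at e1
    rw [abs_of_nonneg (a := 1 - x) (by linarith [hx.2])] at e2
    have e3 : |(swirlInt F (-1) * (1 - x) / 2 + swirlInt F 1 * (1 + x) / 2 - swirlInt F x)
        / (1 - x^2)| ≤ C * K := by
      rw [abs_div, abs_of_pos hpos, div_le_iff₀ hpos]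
      have : swirlInt F (-1) * (1 - x) / 2 + swirlInt F 1 * (1 + x) / 2 - swirlInt F x
          = (1 - x) / 2 * (swirlInt F (-1) - swirlInt F x)
            + (1 + x) / 2 * (swirlInt F 1 - swirlInt F x) := by ring
      rw [this]
      refine (abs_add_le _ _).trans ?_
      rw [abs_mul, abs_mul, abs_of_pos (a := (1 - x) / 2) (by linarith [hx.2]),
        abs_of_pos (a := (1 + x) / 2) (by linarith [hx.1])]
      have f1 := mul_le_mul_of_nonneg_left e1 (a := (1 - x) / 2) (by linarith [hx.2])
      have f2 := mul_le_mul_of_nonneg_left e2 (a := (1 + x) / 2) (by linarith [hx.1])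
      linarith
    have e4 : |(swirlInt F (-1) + swirlInt F 1) / 2| ≤ C * K := by
      have g1 := abs_le.1 (hbd _ hm)
      have g2 := abs_le.1 (hbd _ hp)
      rw [abs_le]; constructor <;> linarith [g1.1, g1.2, g2.1, g2.2]
    rw [Real.rpow_zero, mul_one]
    refine (abs_sub _ _).trans ?_
    linarith

theorem swirlInt_sub {s K L : ℝ} (hs : 0 < s) (hs1 : s < 1) {F G : ℝ → ℝ}
    (hF : WeightBound (-s) K F) (hG : WeightBound (-s) L G) {x : ℝ} (hx : x ∈ Icc (-1:ℝ) 1) :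
    swirlInt (fun y => F y - G y) x = swirlInt F x - swirlInt G x := by
  obtain ⟨C, _, H⟩ := exists_swirlInt_bound hs hs1
  obtain ⟨hF1, hF2⟩ := H F K hF
  obtain ⟨hG1, hG2⟩ := H G L hG
  have h0 : (0:ℝ) ∈ Icc (-1:ℝ) 1 := by norm_num
  have e1 : ∀ t ∈ Ioo (-1:ℝ) 1,
      swirlInt₁ (fun y => F y - G y) t = swirlInt₁ F t - swirlInt₁ G t := by
    intro t ht
    simp only [swirlInt₁, sub_div]
    exact intervalIntegral.integral_sub (intervalIntegrable_zero hF.div.1 ht)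
      (intervalIntegrable_zero hG.div.1 ht)
  have e2 : ∀ l ∈ Ioo (-1:ℝ) 1,
      swirlInt₂ (fun y => F y - G y) l = swirlInt₂ F l - swirlInt₂ G l := by
    intro l hl
    simp only [swirlInt₂]
    rw [← intervalIntegral.integral_sub (intervalIntegrable_zero hF1.1 hl)
      (intervalIntegrable_zero hG1.1 hl)]
    exact intervalIntegral.integral_congr fun t ht => e1 t (uIcc_zero_subset_Ioo hl ht)
  simp only [swirlInt]
  rw [← intervalIntegral.integral_sub (intervalIntegrable_of_bounded hF2 h0 hx)
    (intervalIntegrable_of_bounded hG2 h0 hx)]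
  exact intervalIntegral.integral_congr_uIoo fun l hl => e2 l (uIoo_subset_unit h0 hx hl)

theorem swirlSource_sub {s K L : ℝ} (hs : 0 < s) (hs1 : s < 1) {F G : ℝ → ℝ}
    (hF : WeightBound (-s) K F) (hG : WeightBound (-s) L G) {x : ℝ} (hx : x ∈ Ioo (-1:ℝ) 1) :
    swirlSource (fun y => F y - G y) x = swirlSource F x - swirlSource G x := by
  simp only [swirlSource]
  rw [swirlInt_sub hs hs1 hF hG (Ioo_subset_Icc_self hx),
    swirlInt_sub hs hs1 hF hG (x := 1) (by norm_num),
    swirlInt_sub hs hs1 hF hG (x := -1) (by norm_num)]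
  ring

theorem abs_exp_neg_sub_exp_neg_le {u v M : ℝ} (hu : |u| ≤ M) (hv : |v| ≤ M) :
    |Real.exp (-u) - Real.exp (-v)| ≤ Real.exp M * |u - v| := by
  have key : ∀ u v : ℝ, |u| ≤ M →
      Real.exp (-u) - Real.exp (-v) ≤ Real.exp M * |u - v| := by
    intro u v hu
    have h1 : Real.exp (-v) = Real.exp (-u) * Real.exp (u - v) := by
      rw [← Real.exp_add]; congr 1; ring
    have h2 := Real.add_one_le_exp (u - v)
    have h3 : Real.exp (-u) ≤ Real.exp M := Real.exp_le_exp.2 (by linarith [(abs_le.1 hu).1])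
    have h4 := Real.exp_pos (-u)
    calc Real.exp (-u) - Real.exp (-v) = Real.exp (-u) * (1 - Real.exp (u - v)) := by
          rw [h1]; ring
      _ ≤ Real.exp (-u) * |u - v| :=
          mul_le_mul_of_nonneg_left (by linarith [neg_abs_le (u - v)]) h4.le
      _ ≤ Real.exp M * |u - v| := mul_le_mul_of_nonneg_right h3 (abs_nonneg _)
  rw [abs_le]
  constructor
  · have := key v u hv
    rw [abs_sub_comm] at this
    linarith
  · exact key u v hu

/-- Contraction principle on a ball of the weighted space. -/
theorem exists_weighted_fixedPoint {σ r : ℝ} (hσ : 0 ≤ σ) (hr : 0 ≤ r)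
    {T : (ℝ → ℝ) → ℝ → ℝ}
    (hmap : ∀ h, WeightBound σ r h → WeightBound σ r (T h))
    (hcontr : ∀ h₁ h₂ κ, WeightBound σ r h₁ → WeightBound σ r h₂ →
      WeightBound σ κ (fun x => h₁ x - h₂ x) →
      WeightBound σ (κ / 2) (fun x => T h₁ x - T h₂ x)) :
    ∃ h, WeightBound σ r h ∧ EqOn (T h) h (Ioo (-1:ℝ) 1) := by
  set u : ℕ → ℝ → ℝ := fun n => T^[n] (fun _ => 0) with hu
  have husucc : ∀ n, u (n + 1) = T (u n) := fun n => Function.iterate_succ_apply' T n _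
  have hzero : WeightBound σ r (fun _ => (0:ℝ)) := ⟨continuousOn_const, fun x hx => by
    rw [abs_zero]
    exact mul_nonneg hr (Real.rpow_nonneg (one_sub_sq_pos hx).le _)⟩
  have hball : ∀ n, WeightBound σ r (u n) := by
    intro n
    induction n with
    | zero => exact hzero
    | succ k ih => rw [husucc]; exact hmap _ ih
  have hstep : ∀ n, WeightBound σ (2 * r / 2 ^ n) (fun x => u n x - u (n + 1) x) := by
    intro n
    induction n with
    | zero => exact ((hball 0).sub (hball 1)).mono (by simp; linarith)
    | succ k ih =>
      have := hcontr _ _ _ (hball k) (hball (k + 1)) ih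
      rw [← husucc, ← husucc] at this
      exact this.mono (by rw [pow_succ, div_div])
  have hgeo : ∀ x ∈ Ioo (-1:ℝ) 1, ∀ n,
      dist (u n x) (u (n + 1) x) ≤ (4 * r * (1 - x^2) ^ σ) / 2 / 2 ^ n := by
    intro x hx n
    rw [Real.dist_eq]
    refine ((hstep n).2 x hx).trans (le_of_eq ?_)
    ring
  have hlim : ∀ x, ∃ y, x ∈ Ioo (-1:ℝ) 1 → Tendsto (fun n => u n x) atTop (nhds y) := by
    intro x
    by_cases hx : x ∈ Ioo (-1:ℝ) 1
    · obtain ⟨y, hy⟩ := cauchySeq_tendsto_of_complete (cauchySeq_of_le_geometric_two (hgeo x hx))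
      exact ⟨y, fun _ => hy⟩
    · exact ⟨0, fun h => absurd h hx⟩
  choose h hh using hlim
  have hdist : ∀ n, ∀ x ∈ Ioo (-1:ℝ) 1, |u n x - h x| ≤ 4 * r / 2 ^ n * (1 - x^2) ^ σ := by
    intro n x hx
    have := dist_le_of_le_geometric_two_of_tendsto (hgeo x hx) (hh x hx) n
    rw [Real.dist_eq] at this
    refine this.trans (le_of_eq ?_)
    ring
  have hC0 : Tendsto (fun n : ℕ => 4 * r / (2:ℝ) ^ n) atTop (nhds 0) :=
    tendsto_const_nhds.div_atTop (tendsto_pow_atTop_atTop_of_one_lt (by norm_num))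
  have hcont : ContinuousOn h (Ioo (-1:ℝ) 1) := by
    have hunif : TendstoUniformlyOn u h atTop (Ioo (-1:ℝ) 1) := by
      rw [Metric.tendstoUniformlyOn_iff]
      intro η hη
      filter_upwards [hC0.eventually (gt_mem_nhds hη)] with n hn x hx
      rw [dist_comm, Real.dist_eq]
      refine (hdist n x hx).trans_lt (lt_of_le_of_lt ?_ hn)
      exact mul_le_of_le_one_right (by positivity)
        (Real.rpow_le_one (one_sub_sq_pos hx).le (by nlinarith [sq_nonneg x]) hσ)
    exact hunif.continuousOn (Frequently.of_forall fun n => (hball n).1)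
  have hhball : WeightBound σ r h := ⟨hcont, fun x hx =>
    le_of_tendsto (hh x hx).abs (Eventually.of_forall fun n => (hball n).2 x hx)⟩
  refine ⟨h, hhball, fun x hx => ?_⟩
  have hT : Tendsto (fun n => u (n + 1) x) atTop (nhds (T h x)) := by
    rw [tendsto_iff_dist_tendsto_zero]
    refine squeeze_zero (fun _ => dist_nonneg) (fun n => ?_)
      (g := fun n : ℕ => 4 * r / (2:ℝ) ^ n * ((1 - x^2) ^ σ / 2)) (by simpa using hC0.mul_const _)
    have := (hcontr (u n) h (4 * r / 2 ^ n) (hball n) hhball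
      ⟨(hball n).1.sub hcont, hdist n⟩).2 x hx
    rw [husucc, Real.dist_eq]
    refine this.trans (le_of_eq (by ring))
  exact tendsto_nhds_unique hT ((tendsto_add_atTop_iff_nat 1).2 (hh x hx))

theorem weighted_fixedPoint_unique {σ r : ℝ} {T : (ℝ → ℝ) → ℝ → ℝ}
    (hcontr : ∀ h₁ h₂ κ, WeightBound σ r h₁ → WeightBound σ r h₂ →
      WeightBound σ κ (fun x => h₁ x - h₂ x) →
      WeightBound σ (κ / 2) (fun x => T h₁ x - T h₂ x))
    {h₁ h₂ : ℝ → ℝ} (hb₁ : WeightBound σ r h₁) (hb₂ : WeightBound σ r h₂)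
    (hf₁ : EqOn (T h₁) h₁ (Ioo (-1:ℝ) 1)) (hf₂ : EqOn (T h₂) h₂ (Ioo (-1:ℝ) 1)) :
    EqOn h₁ h₂ (Ioo (-1:ℝ) 1) := by
  have hstep : ∀ n : ℕ, WeightBound σ (2 * r / 2 ^ n) (fun x => h₁ x - h₂ x) := by
    intro n
    induction n with
    | zero => exact (hb₁.sub hb₂).mono (by simp; linarith)
    | succ k ih =>
      refine ((hcontr _ _ _ hb₁ hb₂ ih).congr fun x hx => ?_).mono
        (by rw [pow_succ, div_div])
      simp only [hf₁ hx, hf₂ hx]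
  intro x hx
  have hC0 : Tendsto (fun n : ℕ => 2 * r / (2:ℝ) ^ n * (1 - x^2) ^ σ) atTop (nhds 0) := by
    simpa using (tendsto_const_nhds (x := 2 * r) |>.div_atTop
      (tendsto_pow_atTop_atTop_of_one_lt (r := (2:ℝ)) (by norm_num))).mul_const ((1 - x^2) ^ σ)
  have := ge_of_tendsto hC0 (Eventually.of_forall fun n => (hstep n).2 x hx)
  exact sub_eq_zero.1 (abs_nonpos_iff.1 this)

/-- The weak endpoint condition on the background profile at exponent `s`. -/
structure IsBackground (U : ℝ → ℝ) (s : ℝ) : Prop where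
  cont : ContinuousOn U (Icc (-1:ℝ) 1)
  pos : 0 < s
  lt_one : s < 1
  left : U (-1) < 2 * s
  right : -(U 1) < 2 * s

/-- Derivative of the swirl component with unit slope at the origin, for the profile `U + h`. -/
noncomputable def swirlSlope (U h : ℝ → ℝ) (x : ℝ) : ℝ :=
  Real.exp (-(bF U x) - ∫ s in (0:ℝ)..x, h s / (1 - s^2))

/-- The swirl component with slope `c` and value `d` at the origin, for the profile `U + h`. -/
noncomputable def swirl (U : ℝ → ℝ) (c d : ℝ) (h : ℝ → ℝ) (x : ℝ) : ℝ :=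
  c * (∫ t in (0:ℝ)..x, swirlSlope U h t) + d

/-- The quadratic swirl density `2 Φ Φ'`. -/
noncomputable def swirlDensity (U : ℝ → ℝ) (c d : ℝ) (h : ℝ → ℝ) (x : ℝ) : ℝ :=
  2 * swirl U c d h x * (c * swirlSlope U h x)

/-- Variation of constants for the linearized equation `w' + a' w = N`, `w 0 = 0`. -/
noncomputable def linSolve (U N : ℝ → ℝ) (x : ℝ) : ℝ :=
  V1F U x * ∫ t in (0:ℝ)..x, Real.exp (aF U t) * N t

/-- Nonlinear forcing of the equation for the perturbation. -/
noncomputable def forcing (U : ℝ → ℝ) (β : ℝ × ℝ × ℝ × ℝ) (h : ℝ → ℝ) (x : ℝ) : ℝ :=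
  β.1^2 / 2 + swirlSource (swirlDensity U β.2.2.1 β.2.2.2 h) x - 1 / 2 * (h x * h x / (1 - x^2))

/-- The fixed-point map for the perturbation of `U`. -/
noncomputable def perturbMap (U : ℝ → ℝ) (β : ℝ × ℝ × ℝ × ℝ) (h : ℝ → ℝ) (x : ℝ) : ℝ :=
  β.1 * V1F U x + β.2.1 * V2F U x + linSolve U (forcing U β h) x

namespace IsBackground

variable {U : ℝ → ℝ} {s : ℝ}

theorem contIoo (hU : IsBackground U s) : ContinuousOn U (Ioo (-1:ℝ) 1) :=
  hU.cont.mono Ioo_subset_Icc_self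

theorem hasDerivAt_bF (hU : IsBackground U s) {x : ℝ} (hx : x ∈ Ioo (-1:ℝ) 1) :
    HasDerivAt (bF U) (U x / (1 - x^2)) x :=
  hasDerivAt_primitive (continuousOn_div_one_sub_sq hU.contIoo) hx

theorem continuousOn_aF' (hU : IsBackground U s) :
    ContinuousOn (fun x => (2 * x + U x) / (1 - x^2)) (Ioo (-1:ℝ) 1) :=
  continuousOn_div_one_sub_sq (ContinuousOn.add (by fun_prop) hU.contIoo)

theorem hasDerivAt_aF (hU : IsBackground U s) {x : ℝ} (hx : x ∈ Ioo (-1:ℝ) 1) :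
    HasDerivAt (aF U) ((2 * x + U x) / (1 - x^2)) x :=
  hasDerivAt_primitive hU.continuousOn_aF' hx

theorem exp_aF (hU : IsBackground U s) {x : ℝ} (hx : x ∈ Ioo (-1:ℝ) 1) :
    Real.exp (aF U x) = Real.exp (bF U x) / (1 - x^2) := by
  have h1 : ∫ t in (0:ℝ)..x, 2 * t / (1 - t^2) = -Real.log (1 - x^2) := by
    rw [intervalIntegral.integral_eq_sub_of_hasDerivAt (f := fun t => -Real.log (1 - t^2))]
    · simp
    · intro t ht
      have hpos := one_sub_sq_pos (uIcc_zero_subset_Ioo hx ht)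
      have h : HasDerivAt (fun y : ℝ => 1 - y^2) (-(2*t)) t := by
        simpa using (hasDerivAt_pow 2 t).const_sub 1
      refine (h.log hpos.ne').neg.congr_deriv ?_
      ring
    · exact intervalIntegrable_zero (continuousOn_div_one_sub_sq (by fun_prop)) hx
  have h2 : aF U x = -Real.log (1 - x^2) + bF U x := by
    rw [aF, bF, ← h1, ← intervalIntegral.integral_add]
    · exact intervalIntegral.integral_congr fun t _ => by simp only [add_div]
    · exact intervalIntegrable_zero (continuousOn_div_one_sub_sq (by fun_prop)) hx
    · exact intervalIntegrable_zero (continuousOn_div_one_sub_sq hU.contIoo) hx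
  rw [h2, Real.exp_add, Real.exp_neg, Real.exp_log (one_sub_sq_pos hx)]
  ring

theorem continuousOn_exp_aF_mul (hU : IsBackground U s) {N : ℝ → ℝ}
    (hN : ContinuousOn N (Ioo (-1:ℝ) 1)) :
    ContinuousOn (fun x => Real.exp (aF U x) * N x) (Ioo (-1:ℝ) 1) :=
  ContinuousOn.mul (fun _ hx => (hU.hasDerivAt_aF hx).exp.continuousAt.continuousWithinAt) hN

theorem hasDerivAt_V1F (hU : IsBackground U s) {x : ℝ} (hx : x ∈ Ioo (-1:ℝ) 1) :
    HasDerivAt (V1F U) (-((2 * x + U x) / (1 - x^2) * V1F U x)) x :=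
  (hU.hasDerivAt_aF hx).neg.exp.congr_deriv (by simp only [V1F, Pi.neg_apply]; ring)

theorem V1F_eq (hU : IsBackground U s) {x : ℝ} (hx : x ∈ Ioo (-1:ℝ) 1) :
    V1F U x = Real.exp (-(bF U x)) * (1 - x^2) := by
  rw [V1F, Real.exp_neg, hU.exp_aF hx, Real.exp_neg]
  have := one_sub_sq_pos hx
  field_simp

theorem hasDerivAt_linSolve (hU : IsBackground U s) {N : ℝ → ℝ}
    (hN : ContinuousOn N (Ioo (-1:ℝ) 1)) {x : ℝ} (hx : x ∈ Ioo (-1:ℝ) 1) :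
    HasDerivAt (linSolve U N) (-((2 * x + U x) / (1 - x^2) * linSolve U N x) + N x) x := by
  refine ((hU.hasDerivAt_V1F hx).mul
    (hasDerivAt_primitive (hU.continuousOn_exp_aF_mul hN) hx)).congr_deriv ?_
  have : V1F U x * Real.exp (aF U x) = 1 := by rw [V1F, ← Real.exp_add]; simp
  simp only [linSolve]
  linear_combination N x * this

theorem V2F_eq : V2F U = linSolve U (fun _ => 1) := by
  funext x; simp [V2F, linSolve, V1F]

theorem hasDerivAt_V2F (hU : IsBackground U s) {x : ℝ} (hx : x ∈ Ioo (-1:ℝ) 1) :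
    HasDerivAt (V2F U) (-((2 * x + U x) / (1 - x^2) * V2F U x) + 1) x := by
  rw [V2F_eq]; exact hU.hasDerivAt_linSolve continuousOn_const hx

theorem linSolve_sub (hU : IsBackground U s) {N₁ N₂ : ℝ → ℝ}
    (h₁ : ContinuousOn N₁ (Ioo (-1:ℝ) 1)) (h₂ : ContinuousOn N₂ (Ioo (-1:ℝ) 1)) {x : ℝ}
    (hx : x ∈ Ioo (-1:ℝ) 1) :
    linSolve U N₁ x - linSolve U N₂ x = linSolve U (fun y => N₁ y - N₂ y) x := by
  simp only [linSolve]
  rw [← mul_sub, ← intervalIntegral.integral_sub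
    (intervalIntegrable_zero (hU.continuousOn_exp_aF_mul h₁) hx)
    (intervalIntegrable_zero (hU.continuousOn_exp_aF_mul h₂) hx)]
  simp only [mul_sub]

/-- Uniform bounds for the linear objects attached to the background. -/
theorem exists_linear_bound (hU : IsBackground U s) :
    ∃ C : ℝ, 0 < C ∧ WeightBound (-s) C (fun x => Real.exp (-(bF U x))) ∧
      WeightBound (1 - s) C (V1F U) ∧ WeightBound (1 - s) C (V2F U) ∧
      ∀ (N : ℝ → ℝ) (K : ℝ), WeightBound (-s) K N → WeightBound (1 - s) (C * K) (linSolve U N) := by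
  obtain ⟨C, hC, H⟩ := exists_integral_le_weight (E := fun x => Real.exp (bF U x)) (U := U) (s := s)
    (fun _ _ => Real.exp_pos _)
    (fun x hx => (hU.hasDerivAt_bF hx).exp.congr_deriv (by ring)) hU.cont hU.left hU.right
  have hb : WeightBound (-s) C (fun x => Real.exp (-(bF U x))) := by
    refine ⟨fun x hx => (hU.hasDerivAt_bF hx).neg.exp.continuousAt.continuousWithinAt, ?_⟩
    intro x hx
    have h := (H x hx).1
    rw [abs_of_pos (Real.exp_pos _), Real.exp_neg, inv_le_iff_one_le_mul₀' (Real.exp_pos _)]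
    linarith
  have hV1 : WeightBound (1 - s) C (V1F U) := by
    refine ⟨fun x hx => (hU.hasDerivAt_V1F hx).continuousAt.continuousWithinAt, fun x hx => ?_⟩
    have hpos := one_sub_sq_pos hx
    rw [hU.V1F_eq hx, abs_mul, abs_of_pos hpos, show 1 - s = -s + 1 by ring,
      Real.rpow_add_one hpos.ne', ← mul_assoc]
    exact mul_le_mul_of_nonneg_right (hb.2 x hx) hpos.le
  have hS : ∀ (N : ℝ → ℝ) (K : ℝ), WeightBound (-s) K N →
      WeightBound (1 - s) (C * K) (linSolve U N) := by
    intro N K hN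
    refine ⟨fun x hx => (hU.hasDerivAt_linSolve hN.1 hx).continuousAt.continuousWithinAt,
      fun x hx => ?_⟩
    have hpos := one_sub_sq_pos hx
    have h := (H x hx).2 (fun t => Real.exp (aF U t) * N t) (hU.continuousOn_exp_aF_mul hN.1) K
      (fun y hy => by
        have hy' := one_sub_sq_pos hy
        rw [abs_mul, abs_of_pos (Real.exp_pos _), hU.exp_aF hy, Real.rpow_sub_one hy'.ne']
        have := mul_le_mul_of_nonneg_left (hN.2 y hy)
          (div_pos (Real.exp_pos (bF U y)) hy').le
        refine this.trans (le_of_eq (by ring)))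
    rw [linSolve, hU.V1F_eq hx, abs_mul, abs_mul, abs_of_pos hpos, abs_of_pos (Real.exp_pos _),
      show 1 - s = -s + 1 by ring, Real.rpow_add_one hpos.ne']
    have h2 := mul_le_mul_of_nonneg_left h (mul_pos (Real.exp_pos (-(bF U x))) hpos).le
    refine h2.trans (le_of_eq ?_)
    rw [Real.exp_neg]
    have := Real.exp_pos (bF U x)
    field_simp
  refine ⟨C, hC, hb, hV1, ?_, hS⟩
  rw [V2F_eq]
  have h1 : WeightBound (-s) 1 (fun _ => (1:ℝ)) := by
    simpa using (WeightBound.const 1).weaken (neg_nonpos.2 hU.pos.le)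
  simpa using hS _ 1 h1

theorem hasDerivAt_swirlSlope (hU : IsBackground U s) {h : ℝ → ℝ}
    (hh : ContinuousOn h (Ioo (-1:ℝ) 1)) {x : ℝ} (hx : x ∈ Ioo (-1:ℝ) 1) :
    HasDerivAt (swirlSlope U h) (-((U x + h x) / (1 - x^2) * swirlSlope U h x)) x := by
  refine ((hU.hasDerivAt_bF hx).neg.sub
    (hasDerivAt_primitive (continuousOn_div_one_sub_sq hh) hx)).exp.congr_deriv ?_
  simp only [swirlSlope, Pi.sub_apply, Pi.neg_apply]; ring

theorem continuousOn_swirlSlope (hU : IsBackground U s) {h : ℝ → ℝ}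
    (hh : ContinuousOn h (Ioo (-1:ℝ) 1)) : ContinuousOn (swirlSlope U h) (Ioo (-1:ℝ) 1) :=
  fun _ hx => (hU.hasDerivAt_swirlSlope hh hx).continuousAt.continuousWithinAt

theorem hasDerivAt_swirl (hU : IsBackground U s) {h : ℝ → ℝ} (c d : ℝ)
    (hh : ContinuousOn h (Ioo (-1:ℝ) 1)) {x : ℝ} (hx : x ∈ Ioo (-1:ℝ) 1) :
    HasDerivAt (swirl U c d h) (c * swirlSlope U h x) x :=
  ((hasDerivAt_primitive (hU.continuousOn_swirlSlope hh) hx).const_mul c).add_const d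

theorem exists_swirlSlope_bound (hU : IsBackground U s) :
    ∃ C : ℝ, 0 < C ∧ (∀ h, WeightBound (1 - s) 1 h → WeightBound (-s) C (swirlSlope U h)) ∧
      ∀ h₁ h₂ κ, WeightBound (1 - s) 1 h₁ → WeightBound (1 - s) 1 h₂ →
        WeightBound (1 - s) κ (fun x => h₁ x - h₂ x) →
        WeightBound (-s) (C * κ) (fun x => swirlSlope U h₁ x - swirlSlope U h₂ x) := by
  obtain ⟨C, hC, hb, -⟩ := hU.exists_linear_bound
  set M : ℝ := (1 - s)⁻¹ with hM
  have hM0 : 0 < M := by have := hU.lt_one; rw [hM, inv_pos]; linarith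
  have hprim : ∀ h κ, WeightBound (1 - s) κ h →
      ∀ x ∈ Ioo (-1:ℝ) 1, |∫ t in (0:ℝ)..x, h t / (1 - t^2)| ≤ κ * M := by
    intro h κ hh x hx
    have h1 := hh.div
    rw [show 1 - s - 1 = -s by ring] at h1
    simpa using (h1.primitive hU.pos.le hU.lt_one).2 x hx
  refine ⟨C * Real.exp M + C * (Real.exp M * M), by positivity, ?_, ?_⟩
  · intro h hh
    refine ⟨hU.continuousOn_swirlSlope hh.1, fun x hx => ?_⟩
    rw [swirlSlope, abs_of_pos (Real.exp_pos _), sub_eq_add_neg, Real.exp_add]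
    have h1 := hprim h 1 hh x hx
    rw [one_mul] at h1
    have h2 : Real.exp (-∫ t in (0:ℝ)..x, h t / (1 - t^2)) ≤ Real.exp M :=
      Real.exp_le_exp.2 (by linarith [(abs_le.1 h1).1])
    have h3 := hb.2 x hx
    rw [abs_of_pos (Real.exp_pos _)] at h3
    have hw := (Real.rpow_pos_of_pos (one_sub_sq_pos hx) (-s))
    calc _ ≤ C * (1 - x^2) ^ (-s) * Real.exp M :=
          mul_le_mul h3 h2 (Real.exp_pos _).le (by positivity)
      _ = C * Real.exp M * (1 - x^2) ^ (-s) := by ring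
      _ ≤ _ := mul_le_mul_of_nonneg_right (by linarith [show 0 < C * (Real.exp M * M) by positivity])
          hw.le
  · intro h₁ h₂ κ hh₁ hh₂ hh
    refine ⟨(hU.continuousOn_swirlSlope hh₁.1).sub (hU.continuousOn_swirlSlope hh₂.1),
      fun x hx => ?_⟩
    have h1 := hprim h₁ 1 hh₁ x hx
    have h2 := hprim h₂ 1 hh₂ x hx
    rw [one_mul] at h1 h2
    have h3 := abs_exp_neg_sub_exp_neg_le h1 h2
    have h4 := hprim _ κ hh x hx
    simp only [sub_div] at h4
    rw [intervalIntegral.integral_sub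
      (intervalIntegrable_zero (continuousOn_div_one_sub_sq hh₁.1) hx)
      (intervalIntegrable_zero (continuousOn_div_one_sub_sq hh₂.1) hx)] at h4
    have h5 := hb.2 x hx
    have hw := (Real.rpow_pos_of_pos (one_sub_sq_pos hx) (-s))
    have hκ := hh.nonneg
    simp only [swirlSlope, sub_eq_add_neg (-(bF U x)), Real.exp_add]
    rw [← mul_sub, abs_mul]
    calc _ ≤ C * (1 - x^2) ^ (-s) * (Real.exp M * (κ * M)) :=
          mul_le_mul h5 (h3.trans (mul_le_mul_of_nonneg_left h4 (Real.exp_pos _).le))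
            (abs_nonneg _) (by positivity)
      _ = C * (Real.exp M * M) * κ * (1 - x^2) ^ (-s) := by ring
      _ ≤ _ := by
          refine mul_le_mul_of_nonneg_right (mul_le_mul_of_nonneg_right ?_ hκ) hw.le
          linarith [show 0 < C * Real.exp M by positivity]

theorem exists_swirlDensity_bound (hU : IsBackground U s) :
    ∃ C : ℝ, 0 < C ∧ ∀ c d B : ℝ, |c| ≤ B → |d| ≤ B →
      (∀ h, WeightBound (1 - s) 1 h → WeightBound (-s) (C * B^2) (swirlDensity U c d h)) ∧
      ∀ h₁ h₂ κ, WeightBound (1 - s) 1 h₁ → WeightBound (1 - s) 1 h₂ →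
        WeightBound (1 - s) κ (fun x => h₁ x - h₂ x) →
        WeightBound (-s) (C * B^2 * κ)
          (fun x => swirlDensity U c d h₁ x - swirlDensity U c d h₂ x) := by
  obtain ⟨C, hC, Hb, Hd⟩ := hU.exists_swirlSlope_bound
  set M : ℝ := (1 - s)⁻¹ with hM
  have hM0 : 0 < M := by have := hU.lt_one; rw [hM, inv_pos]; linarith
  refine ⟨2 * (C * (C * M)) + 2 * (C * M + 1) * C, by positivity, fun c d B hc hd => ?_⟩
  have hB : 0 ≤ B := (abs_nonneg _).trans hc
  have hslope : ∀ h, WeightBound (1 - s) 1 h →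
      WeightBound (-s) (B * C) (fun x => c * swirlSlope U h x) := fun h hh =>
    ((Hb h hh).const_mul c).mono (mul_le_mul_of_nonneg_right hc hC.le)
  have hswirl : ∀ h, WeightBound (1 - s) 1 h →
      WeightBound 0 (B * (C * M + 1)) (swirl U c d h) := fun h hh =>
    ((((Hb h hh).primitive hU.pos.le hU.lt_one).const_mul c).add (WeightBound.const d)).mono (by
      have : |c| * (C * M) ≤ B * (C * M) := mul_le_mul_of_nonneg_right hc (by positivity)
      change |c| * (C * M) + |d| ≤ _
      linarith)
  refine ⟨fun h hh => ?_, fun h₁ h₂ κ hh₁ hh₂ hh => ?_⟩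
  · have h1 := ((hswirl h hh).mul (hslope h hh)).const_mul 2
    rw [zero_add] at h1
    refine (h1.congr fun x _ => ?_).mono ?_
    · simp only [swirlDensity]; ring
    · rw [abs_two]
      have : 0 ≤ 2 * (C * (C * M)) * B^2 := by positivity
      linarith
  · have hκ := hh.nonneg
    have e1 : WeightBound (-s) (B * (C * κ))
        (fun x => c * (swirlSlope U h₁ x - swirlSlope U h₂ x)) :=
      ((Hd h₁ h₂ κ hh₁ hh₂ hh).const_mul c).mono (mul_le_mul_of_nonneg_right hc (by positivity))
    have e2 : WeightBound 0 (B * (C * κ * M)) (fun x => swirl U c d h₁ x - swirl U c d h₂ x) := by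
      refine ((((Hd h₁ h₂ κ hh₁ hh₂ hh).primitive hU.pos.le hU.lt_one).const_mul c).congr
        fun x hx => ?_).mono (mul_le_mul_of_nonneg_right hc (by positivity))
      simp only [swirl]
      rw [intervalIntegral.integral_sub
        (intervalIntegrable_zero (hU.continuousOn_swirlSlope hh₁.1) hx)
        (intervalIntegrable_zero (hU.continuousOn_swirlSlope hh₂.1) hx)]
      ring
    have e3 := ((e2.mul (hslope h₁ hh₁)).add ((hswirl h₂ hh₂).mul e1)).const_mul 2
    rw [zero_add] at e3
    refine (e3.congr fun x _ => ?_).mono ?_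
    · simp only [swirlDensity]; ring
    · rw [abs_two]
      exact le_of_eq (by ring)

theorem exists_forcing_bound (hU : IsBackground U s) :
    ∃ C : ℝ, 0 < C ∧ ∀ β : ℝ × ℝ × ℝ × ℝ,
      (∀ h ρ, ρ ≤ 1 → WeightBound (1 - s) ρ h →
        WeightBound (-s) (C * (‖β‖^2 + ρ^2)) (forcing U β h)) ∧
      ∀ h₁ h₂ ρ κ, ρ ≤ 1 → WeightBound (1 - s) ρ h₁ → WeightBound (1 - s) ρ h₂ →
        WeightBound (1 - s) κ (fun x => h₁ x - h₂ x) →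
        WeightBound (-s) (C * (‖β‖^2 + ρ) * κ)
          (fun x => forcing U β h₁ x - forcing U β h₂ x) := by
  obtain ⟨C₁, hC₁, H₁⟩ := hU.exists_swirlDensity_bound
  obtain ⟨C₂, hC₂, H₂⟩ := exists_swirlSource_bound hU.pos hU.lt_one
  have hs := hU.pos
  have hs1 := hU.lt_one
  refine ⟨C₂ * C₁ + 1, by positivity, fun β => ?_⟩
  have hb1 : |β.1| ≤ ‖β‖ := norm_fst_le β
  have hb3 : |β.2.2.1| ≤ ‖β‖ := (norm_fst_le _).trans ((norm_snd_le _).trans (norm_snd_le β))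
  have hb4 : |β.2.2.2| ≤ ‖β‖ := (norm_snd_le _).trans ((norm_snd_le _).trans (norm_snd_le β))
  obtain ⟨Hb, Hd⟩ := H₁ _ _ _ hb3 hb4
  refine ⟨fun h ρ hρ hh => ?_, fun h₁ h₂ ρ κ hρ hh₁ hh₂ hh => ?_⟩
  · obtain ⟨-, -, -, -, e1⟩ := H₂ _ _ (Hb h (hh.mono hρ))
    have e2 := ((hh.mul hh).div.const_mul (1/2)).weaken (τ := -s) (by linarith)
    have e3 := ((WeightBound.const (β.1^2 / 2)).add e1).weaken (τ := -s) (by linarith)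
    refine (e3.sub e2).mono ?_
    rw [abs_of_nonneg (by positivity), abs_of_nonneg (by norm_num : (0:ℝ) ≤ 1/2)]
    have : β.1^2 ≤ ‖β‖^2 := sq_le_sq.2 (by rwa [abs_norm])
    have : 0 ≤ C₂ * C₁ * ρ^2 := by positivity
    nlinarith [sq_nonneg ‖β‖, sq_nonneg ρ]
  · have k1 := Hb h₁ (hh₁.mono hρ)
    have k2 := Hb h₂ (hh₂.mono hρ)
    obtain ⟨-, -, -, -, e1⟩ := H₂ _ _ (Hd h₁ h₂ κ (hh₁.mono hρ) (hh₂.mono hρ) hh)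
    have e2 := (((hh₁.add hh₂).mul hh).div.const_mul (1/2)).weaken (τ := -s) (by linarith)
    have e3 := e1.weaken (τ := -s) (by linarith)
    refine ((e3.sub e2).congr fun x hx => ?_).mono ?_
    · simp only [forcing]
      rw [swirlSource_sub hs hs1 k1 k2 hx]
      ring
    · rw [abs_of_nonneg (by norm_num : (0:ℝ) ≤ 1/2)]
      have hκ := hh.nonneg
      have hρ0 := hh₁.nonneg
      have : 0 ≤ ‖β‖^2 * κ := by positivity
      have : 0 ≤ C₂ * C₁ * ρ * κ := by positivity
      nlinarith

end IsBackground

namespace IsBackground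

variable {U : ℝ → ℝ} {s : ℝ}

/-- The fixed-point map is a contraction on a small ball and has, for small parameters, a fixed
point of size comparable to the parameter, with a quadratically small nonlinear part. -/
theorem exists_perturbation (hU : IsBackground U s) :
    ∃ C r δ : ℝ, 0 < C ∧ 0 < r ∧ r ≤ 1 ∧ 0 < δ ∧ ∀ β : ℝ × ℝ × ℝ × ℝ, ‖β‖ < δ →
      C * ‖β‖ ≤ 1 ∧
      (∃ h, WeightBound (1 - s) r h ∧ WeightBound (1 - s) (C * ‖β‖) h ∧
        EqOn (perturbMap U β h) h (Ioo (-1:ℝ) 1) ∧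
        WeightBound (-s) (C * ‖β‖^2) (forcing U β h) ∧
        WeightBound (1 - s) (C * ‖β‖^2) (linSolve U (forcing U β h))) ∧
      ∀ h₁ h₂, WeightBound (1 - s) r h₁ → WeightBound (1 - s) r h₂ →
        EqOn (perturbMap U β h₁) h₁ (Ioo (-1:ℝ) 1) →
        EqOn (perturbMap U β h₂) h₂ (Ioo (-1:ℝ) 1) → EqOn h₁ h₂ (Ioo (-1:ℝ) 1) := by
  obtain ⟨A, hA, -, hV1, hV2, HS⟩ := hU.exists_linear_bound
  obtain ⟨B, hB, HN⟩ := hU.exists_forcing_bound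
  set D := A * B with hD
  have hD0 : 0 < D := by positivity
  set K := 4 * (2 * A + D) with hK
  have hK0 : 0 < K := by positivity
  set r := min 1 (1 / (4 * D)) with hr
  have hr0 : 0 < r := by positivity
  have hr1 : r ≤ 1 := min_le_left _ _
  have hDr : D * r ≤ 1 / 4 := by
    have : r ≤ 1 / (4 * D) := min_le_right _ _
    rw [le_div_iff₀ (by positivity)] at this
    linarith
  set δ := min 1 (r / K) with hδ
  have hδ0 : 0 < δ := by positivity
  refine ⟨max K (max (D * (1 + K^2)) (B * (1 + K^2))), r,
    min δ (1 / max K (max (D * (1 + K^2)) (B * (1 + K^2)))), by positivity, hr0, hr1,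
    by positivity, fun β hβ' => ?_⟩
  have hβ := hβ'.trans_le (min_le_left _ _)
  have hn := norm_nonneg β
  have hβ1 : ‖β‖ ≤ 1 := hβ.le.trans (min_le_left _ _)
  have hβK : K * ‖β‖ ≤ r := by
    have : ‖β‖ ≤ r / K := hβ.le.trans (min_le_right _ _)
    rw [le_div_iff₀ hK0] at this
    linarith
  obtain ⟨Hb, Hd⟩ := HN β
  have hsq : ‖β‖^2 ≤ ‖β‖ := by nlinarith
  have hDβ : D * ‖β‖^2 ≤ K * ‖β‖ / 4 := by
    have : D * ‖β‖^2 ≤ D * ‖β‖ := mul_le_mul_of_nonneg_left hsq hD0.le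
    have : 0 ≤ A * ‖β‖ := by positivity
    rw [hK]; linarith
  have hb1 : |β.1| ≤ ‖β‖ := norm_fst_le β
  have hb2 : |β.2.1| ≤ ‖β‖ := (norm_fst_le _).trans (norm_snd_le β)
  have hmap : ∀ ρ, K * ‖β‖ ≤ ρ → ρ ≤ r → ∀ h, WeightBound (1 - s) ρ h →
      WeightBound (1 - s) ρ (perturbMap U β h) := by
    intro ρ h1 h2 h hh
    have hρ := hh.nonneg
    refine (((hV1.const_mul β.1).add (hV2.const_mul β.2.1)).add
      (HS _ _ (Hb h ρ (h2.trans hr1) hh))).mono ?_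
    have e1 : |β.1| * A ≤ ‖β‖ * A := mul_le_mul_of_nonneg_right hb1 hA.le
    have e2 : |β.2.1| * A ≤ ‖β‖ * A := mul_le_mul_of_nonneg_right hb2 hA.le
    have e3 : D * ρ^2 ≤ ρ / 4 := by
      have : D * ρ ≤ D * r := mul_le_mul_of_nonneg_left h2 hD0.le
      nlinarith
    have e4 : 0 ≤ D * ‖β‖ := by positivity
    have e5 : A * (B * (‖β‖^2 + ρ^2)) = D * ‖β‖^2 + D * ρ^2 := by rw [hD]; ring
    have e6 : K * ‖β‖ = 8 * (‖β‖ * A) + 4 * (D * ‖β‖) := by rw [hK]; ring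
    rw [e5]; linarith
  have hcontr : ∀ ρ, ρ ≤ r → ∀ h₁ h₂ κ, WeightBound (1 - s) ρ h₁ → WeightBound (1 - s) ρ h₂ →
      WeightBound (1 - s) κ (fun x => h₁ x - h₂ x) →
      WeightBound (1 - s) (κ / 2) (fun x => perturbMap U β h₁ x - perturbMap U β h₂ x) := by
    intro ρ hρr h₁ h₂ κ hh₁ hh₂ hh
    have hρ1 := hρr.trans hr1
    have hκ := hh.nonneg
    refine ((HS _ _ (Hd h₁ h₂ ρ κ hρ1 hh₁ hh₂ hh)).congr fun x hx => ?_).mono ?_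
    · simp only [perturbMap]
      rw [← hU.linSolve_sub (Hb h₁ ρ hρ1 hh₁).1 (Hb h₂ ρ hρ1 hh₂).1 hx]
      ring
    · have e1 : D * ρ ≤ D * r := mul_le_mul_of_nonneg_left hρr hD0.le
      have e2 : D * ‖β‖^2 + D * ρ ≤ 1 / 2 := by linarith
      have := mul_le_mul_of_nonneg_right e2 hκ
      calc A * (B * (‖β‖^2 + ρ) * κ) = (D * ‖β‖^2 + D * ρ) * κ := by rw [hD]; ring
        _ ≤ _ := this
        _ = κ / 2 := by ring
  obtain ⟨h, hh, hfix⟩ := exists_weighted_fixedPoint (r := K * ‖β‖) (by linarith [hU.lt_one])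
    (by positivity) (hmap _ le_rfl hβK) (hcontr _ hβK)
  have hmax1 : K ≤ max K (max (D * (1 + K^2)) (B * (1 + K^2))) := le_max_left _ _
  have hmax2 : D * (1 + K^2) ≤ max K (max (D * (1 + K^2)) (B * (1 + K^2))) :=
    (le_max_left _ _).trans (le_max_right _ _)
  have hmax3 : B * (1 + K^2) ≤ max K (max (D * (1 + K^2)) (B * (1 + K^2))) :=
    (le_max_right _ _).trans (le_max_right _ _)
  set M := max K (max (D * (1 + K^2)) (B * (1 + K^2))) with hM
  have hM0 : 0 < M := hK0.trans_le hmax1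
  have hforce := Hb h (K * ‖β‖) (hβK.trans hr1) hh
  have hn2 : 0 ≤ ‖β‖^2 := by positivity
  refine ⟨?_, ⟨h, hh.mono hβK, hh.mono (mul_le_mul_of_nonneg_right hmax1 hn), hfix,
    hforce.mono ?_, (HS _ _ hforce).mono ?_⟩, ?_⟩
  · have := (hβ'.trans_le (min_le_right _ _)).le
    rwa [le_div_iff₀ hM0, mul_comm] at this
  · calc B * (‖β‖^2 + (K * ‖β‖)^2) = B * (1 + K^2) * ‖β‖^2 := by ring
      _ ≤ _ := mul_le_mul_of_nonneg_right hmax3 hn2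
  · calc A * (B * (‖β‖^2 + (K * ‖β‖)^2)) = D * (1 + K^2) * ‖β‖^2 := by rw [hD]; ring
      _ ≤ _ := mul_le_mul_of_nonneg_right hmax2 hn2
  · intro h₁ h₂ hb₁ hb₂ hf₁ hf₂
    exact weighted_fixedPoint_unique (hcontr r le_rfl) hb₁ hb₂ hf₁ hf₂

end IsBackground

/-- The function and its first `n` derivatives are bounded by `K` on `(-1/2, 1/2)`. -/
def DerivBound : ℕ → ℝ → (ℝ → ℝ) → Prop
  | 0, K, f => ∀ x ∈ Ioo (-(1:ℝ)/2) (1/2), |f x| ≤ K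
  | n + 1, K, f => (∀ x ∈ Ioo (-(1:ℝ)/2) (1/2), |f x| ≤ K ∧ DifferentiableAt ℝ f x) ∧
      DerivBound n K (deriv f)

theorem half_mem_Ioo {x : ℝ} (hx : x ∈ Ioo (-(1:ℝ)/2) (1/2)) : x ∈ Ioo (-1:ℝ) 1 :=
  ⟨by linarith [hx.1], by linarith [hx.2]⟩

theorem deriv_eqOn_half {f g : ℝ → ℝ} (h : EqOn g f (Ioo (-(1:ℝ)/2) (1/2))) :
    EqOn (deriv g) (deriv f) (Ioo (-(1:ℝ)/2) (1/2)) :=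
  fun _ hx => (h.eventuallyEq_of_mem (isOpen_Ioo.mem_nhds hx)).deriv_eq

namespace DerivBound

variable {n : ℕ} {K L : ℝ} {f g : ℝ → ℝ}

theorem bound (hf : DerivBound n K f) : ∀ x ∈ Ioo (-(1:ℝ)/2) (1/2), |f x| ≤ K := by
  cases n with
  | zero => exact hf
  | succ n => exact fun x hx => (hf.1 x hx).1

theorem nonneg (hf : DerivBound n K f) : 0 ≤ K :=
  (abs_nonneg _).trans (hf.bound 0 (by norm_num))

theorem congr (hf : DerivBound n K f) (h : EqOn g f (Ioo (-(1:ℝ)/2) (1/2))) :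
    DerivBound n K g := by
  induction n generalizing f g with
  | zero => exact fun x hx => by rw [h hx]; exact hf x hx
  | succ n ih =>
    refine ⟨fun x hx => ⟨by rw [h hx]; exact (hf.1 x hx).1, ?_⟩, ih hf.2 (deriv_eqOn_half h)⟩
    exact (hf.1 x hx).2.congr_of_eventuallyEq (h.eventuallyEq_of_mem (isOpen_Ioo.mem_nhds hx))

theorem mono (hf : DerivBound n K f) (h : K ≤ L) : DerivBound n L f := by
  induction n generalizing f with
  | zero => exact fun x hx => (hf x hx).trans h
  | succ n ih => exact ⟨fun x hx => ⟨(hf.1 x hx).1.trans h, (hf.1 x hx).2⟩, ih hf.2⟩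

theorem lower (hf : DerivBound (n + 1) K f) : DerivBound n K f := by
  induction n generalizing f with
  | zero => exact hf.bound
  | succ n ih => exact ⟨hf.1, ih hf.2⟩

theorem of_le {m : ℕ} (hf : DerivBound n K f) (h : m ≤ n) : DerivBound m K f := by
  induction n, h using Nat.le_induction with
  | base => exact hf
  | succ n _ ih => exact ih hf.lower

theorem of_hasDerivAt (hd : ∀ x ∈ Ioo (-(1:ℝ)/2) (1/2), HasDerivAt f (g x) x)
    (hf : ∀ x ∈ Ioo (-(1:ℝ)/2) (1/2), |f x| ≤ K) (hg : DerivBound n K g) :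
    DerivBound (n + 1) K f :=
  ⟨fun x hx => ⟨hf x hx, (hd x hx).differentiableAt⟩, hg.congr fun x hx => (hd x hx).deriv⟩

theorem const (c : ℝ) : DerivBound n |c| (fun _ => c) := by
  induction n generalizing c with
  | zero => exact fun x _ => le_rfl
  | succ n ih =>
    exact of_hasDerivAt (g := fun _ => 0) (fun x _ => hasDerivAt_const x c) (fun _ _ => le_rfl)
      ((ih 0).mono (by simp))

theorem add (hf : DerivBound n K f) (hg : DerivBound n L g) :
    DerivBound n (K + L) (fun x => f x + g x) := by
  induction n generalizing f g with
  | zero => exact fun x hx => (abs_add_le _ _).trans (add_le_add (hf x hx) (hg x hx))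
  | succ n ih =>
    exact of_hasDerivAt (g := fun x => deriv f x + deriv g x)
      (fun x hx => (hf.1 x hx).2.hasDerivAt.add (hg.1 x hx).2.hasDerivAt)
      (fun x hx => (abs_add_le _ _).trans (add_le_add (hf.1 x hx).1 (hg.1 x hx).1)) (ih hf.2 hg.2)

theorem mul (hf : DerivBound n K f) (hg : DerivBound n L g) :
    DerivBound n (2^n * (K * L)) (fun x => f x * g x) := by
  have hK := hf.nonneg
  have hL := hg.nonneg
  have hb : ∀ x ∈ Ioo (-(1:ℝ)/2) (1/2), |f x * g x| ≤ K * L := fun x hx => by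
    rw [abs_mul]; exact mul_le_mul (hf.bound x hx) (hg.bound x hx) (abs_nonneg _) hK
  induction n generalizing f g with
  | zero => exact fun x hx => by simpa using hb x hx
  | succ n ih =>
    refine of_hasDerivAt (g := fun x => deriv f x * g x + f x * deriv g x)
      (fun x hx => (hf.1 x hx).2.hasDerivAt.mul (hg.1 x hx).2.hasDerivAt) ?_ ?_
    · intro x hx
      refine (hb x hx).trans (le_mul_of_one_le_left (by positivity) (one_le_pow₀ (by norm_num)))
    · have hb' : ∀ {f g : ℝ → ℝ}, DerivBound n K f → DerivBound n L g →
          ∀ x ∈ Ioo (-(1:ℝ)/2) (1/2), |f x * g x| ≤ K * L := fun hf hg x hx => by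
        rw [abs_mul]; exact mul_le_mul (hf.bound x hx) (hg.bound x hx) (abs_nonneg _) hK
      refine ((ih hf.2 hg.lower (hb' hf.2 hg.lower)).add
        (ih hf.lower hg.2 (hb' hf.lower hg.2))).mono (le_of_eq ?_)
      ring

theorem const_mul (c : ℝ) (hf : DerivBound n K f) : DerivBound n (|c| * K) (fun x => c * f x) := by
  induction n generalizing f with
  | zero =>
    exact fun x hx => by rw [abs_mul]; exact mul_le_mul_of_nonneg_left (hf x hx) (abs_nonneg c)
  | succ n ih =>
    refine of_hasDerivAt (fun x hx => (hf.1 x hx).2.hasDerivAt.const_mul c) ?_ (ih hf.2)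
    exact fun x hx => by
      rw [abs_mul]; exact mul_le_mul_of_nonneg_left (hf.1 x hx).1 (abs_nonneg c)

theorem exists_of_contDiffOn (hf : ContDiffOn ℝ n f (Ioo (-1:ℝ) 1)) :
    ∃ C, DerivBound n C f := by
  have hbd : ∀ {f : ℝ → ℝ}, ContinuousOn f (Ioo (-1:ℝ) 1) →
      ∃ C, ∀ x ∈ Ioo (-(1:ℝ)/2) (1/2), |f x| ≤ C := by
    intro f hf
    obtain ⟨C, hC⟩ := (isCompact_Icc (a := (-(1:ℝ)/2)) (b := 1/2)).exists_bound_of_continuousOn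
      (hf.mono fun x hx => ⟨by linarith [hx.1], by linarith [hx.2]⟩)
    exact ⟨C, fun x hx => hC x (Ioo_subset_Icc_self hx)⟩
  induction n generalizing f with
  | zero => exact hbd hf.continuousOn
  | succ n ih =>
    push_cast at hf
    obtain ⟨hdiff, -, hd⟩ := (contDiffOn_succ_iff_deriv_of_isOpen isOpen_Ioo).1 hf
    obtain ⟨C₁, h₁⟩ := hbd hf.continuousOn
    obtain ⟨C₂, h₂⟩ := ih hd
    refine ⟨max C₁ C₂, fun x hx => ⟨(h₁ x hx).trans (le_max_left _ _), ?_⟩,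
      h₂.mono (le_max_right _ _)⟩
    exact (hdiff x (half_mem_Ioo hx)).differentiableAt (isOpen_Ioo.mem_nhds (half_mem_Ioo hx))

/-- Linear first-order equations gain one derivative. -/
theorem exists_ode_bound (n : ℕ) (A : ℝ → ℝ) (a : ℝ) (hA : DerivBound n a A) :
    ∃ c, 0 < c ∧ ∀ (f N : ℝ → ℝ) (K : ℝ), DerivBound n K N →
      (∀ x ∈ Ioo (-(1:ℝ)/2) (1/2), |f x| ≤ K) →
      (∀ x ∈ Ioo (-(1:ℝ)/2) (1/2), HasDerivAt f (-(A x * f x) + N x) x) →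
      DerivBound (n + 1) (c * K) f := by
  have ha := hA.nonneg
  have key : ∀ (k : ℕ) (c : ℝ), 1 ≤ c → k ≤ n → ∀ (f N : ℝ → ℝ) (K : ℝ), DerivBound k K N →
      DerivBound k (c * K) f →
      (∀ x ∈ Ioo (-(1:ℝ)/2) (1/2), HasDerivAt f (-(A x * f x) + N x) x) →
      DerivBound (k + 1) ((2^k * a * c + 1 + c) * K) f := by
    intro k c hc hk f N K hN hf hd
    have hK := hN.nonneg
    refine of_hasDerivAt hd (fun x hx => (hf.bound x hx).trans ?_)
      (((((hA.of_le hk).mul hf).const_mul (-1)).add hN).mono ?_ |>.congr fun x _ => ?_)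
    · have : 0 ≤ 2^k * a * c * K := by positivity
      nlinarith
    · have : 0 ≤ c * K := by positivity
      rw [abs_neg, abs_one]; nlinarith
    · simp
  have main : ∀ k ≤ n, ∃ c, 1 ≤ c ∧ ∀ (f N : ℝ → ℝ) (K : ℝ), DerivBound k K N →
      (∀ x ∈ Ioo (-(1:ℝ)/2) (1/2), |f x| ≤ K) →
      (∀ x ∈ Ioo (-(1:ℝ)/2) (1/2), HasDerivAt f (-(A x * f x) + N x) x) →
      DerivBound (k + 1) (c * K) f := by
    intro k
    induction k with
    | zero =>
      refine fun _ => ⟨2^0 * a * 1 + 1 + 1, by linarith, fun f N K hN hf hd => ?_⟩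
      exact key 0 1 le_rfl (Nat.zero_le n) f N K hN (by simpa [DerivBound] using hf) hd
    | succ k ih =>
      intro hk
      obtain ⟨c, hc, h⟩ := ih (Nat.le_of_succ_le hk)
      refine ⟨2^(k+1) * a * c + 1 + c, ?_, fun f N K hN hf hd => ?_⟩
      · have : 0 ≤ 2^(k+1) * a * c := by positivity
        linarith
      · exact key (k + 1) c hc hk f N K hN (h f N K hN.lower hf hd) hd
  obtain ⟨c, hc, h⟩ := main n le_rfl
  exact ⟨c, by linarith, h⟩

end DerivBound

theorem WeightBound.half {σ K : ℝ} {f : ℝ → ℝ} (hf : WeightBound σ K f) (hσ : -1 ≤ σ) :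
    ∀ x ∈ Ioo (-(1:ℝ)/2) (1/2), |f x| ≤ 2 * K := by
  intro x hx
  have hK := hf.nonneg
  have h1 : (1/2 : ℝ) ≤ 1 - x^2 := by nlinarith [hx.1, hx.2]
  have h2 : 1 - x^2 ≤ 1 := by nlinarith
  have h3 : (1 - x^2) ^ σ ≤ 2 := by
    refine (Real.rpow_le_rpow_of_exponent_ge (by linarith) h2 hσ).trans ?_
    rw [Real.rpow_neg_one, inv_le_comm₀ (by linarith) (by norm_num)]
    linarith
  calc |f x| ≤ K * (1 - x^2) ^ σ := hf.2 x (half_mem_Ioo hx)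
    _ ≤ K * 2 := mul_le_mul_of_nonneg_left h3 hK
    _ = 2 * K := mul_comm _ _

theorem contDiffOn_inv_one_sub_sq {n : WithTop ℕ∞} :
    ContDiffOn ℝ n (fun x : ℝ => (1 - x^2)⁻¹) (Ioo (-1:ℝ) 1) :=
  ContDiffOn.inv (by fun_prop) fun _ hx => (one_sub_sq_pos hx).ne'

theorem exists_derivBound_swirlSource {s : ℝ} (hs : 0 < s) (hs1 : s < 1) :
    ∃ C : ℝ, 0 < C ∧ ∀ (F : ℝ → ℝ) (K : ℝ), WeightBound (-s) K F →
      DerivBound 2 (C * K) (swirlSource F) := by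
  obtain ⟨C, hC, H⟩ := exists_swirlSource_bound hs hs1
  obtain ⟨a, ha⟩ := DerivBound.exists_of_contDiffOn (n := 2) (f := fun x : ℝ => x)
    contDiffOn_fun_id
  obtain ⟨b, hb⟩ := DerivBound.exists_of_contDiffOn (n := 2) contDiffOn_inv_one_sub_sq
  have ha0 := ha.nonneg
  have hb0 := hb.nonneg
  refine ⟨2^2 * ((3 + a) * C * b) + C, by positivity, fun F K hF => ?_⟩
  obtain ⟨h1, h2, -, h3, -⟩ := H F K hF
  have hI := fun x (hx : x ∈ Ioo (-(1:ℝ)/2) (1/2)) => hasDerivAt_swirlInt hs hs1 hF (half_mem_Ioo hx)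
  have hK := hF.nonneg
  have hCK : C * K ≤ 2 * (C * K) := by have : 0 ≤ C * K := by positivity
                                       linarith
  have hbI : DerivBound 2 (2 * (C * K)) (swirlInt F) :=
    DerivBound.of_hasDerivAt (fun x hx => (hI x hx).2.2)
      (fun x hx => (h3 x (Ioo_subset_Icc_self (half_mem_Ioo hx))).trans hCK)
      (DerivBound.of_hasDerivAt (n := 0) (fun x hx => (hI x hx).2.1) (h2.half (by norm_num))
        (h1.half (by linarith)))
  have hl := h3 (-1) (by norm_num)
  have hr := h3 1 (by norm_num)
  have hq : |(swirlInt F (-1) + swirlInt F 1) / 2| ≤ C * K := by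
    rw [abs_le] at *; constructor <;> linarith
  have hr : |(swirlInt F 1 - swirlInt F (-1)) / 2| ≤ C * K := by
    rw [abs_le] at *; constructor <;> linarith
  refine ((((((DerivBound.const _).add (ha.const_mul _)).add (hbI.const_mul (-1))).mul hb).add
    (DerivBound.const (-((swirlInt F (-1) + swirlInt F 1) / 2)))).congr
      (f := fun x => ((swirlInt F (-1) + swirlInt F 1) / 2
        + (swirlInt F 1 - swirlInt F (-1)) / 2 * x + -1 * swirlInt F x) * (1 - x^2)⁻¹
        + -((swirlInt F (-1) + swirlInt F 1) / 2)) fun x _ => ?_).mono ?_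
  · simp only [swirlSource]; ring
  · rw [abs_neg, abs_neg, abs_one]
    have e1 := mul_le_mul_of_nonneg_right hr ha0
    have e2 := mul_le_mul_of_nonneg_right (add_le_add hq e1) hb0
    nlinarith

namespace IsBackground

variable {U : ℝ → ℝ} {s : ℝ}

theorem exists_derivBound_forcing (hU : IsBackground U s) :
    ∃ C : ℝ, 0 < C ∧ ∀ (β : ℝ × ℝ × ℝ × ℝ) (h : ℝ → ℝ) (k : ℕ) (L : ℝ), k ≤ 2 →
      WeightBound (1 - s) 1 h → DerivBound k L h →
      DerivBound k (C * (‖β‖^2 + L^2)) (forcing U β h) := by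
  obtain ⟨C₁, hC₁, H₁⟩ := hU.exists_swirlDensity_bound
  obtain ⟨C₂, hC₂, H₂⟩ := exists_derivBound_swirlSource hU.pos hU.lt_one
  obtain ⟨b, hb⟩ := DerivBound.exists_of_contDiffOn (n := 2) contDiffOn_inv_one_sub_sq
  have hb0 := hb.nonneg
  refine ⟨C₂ * C₁ + 1 + 16 * b, by positivity, fun β h k L hk hh hL => ?_⟩
  have hL0 := hL.nonneg
  have hb1 : |β.1| ≤ ‖β‖ := norm_fst_le β
  have hb3 : |β.2.2.1| ≤ ‖β‖ := (norm_fst_le _).trans ((norm_snd_le _).trans (norm_snd_le β))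
  have hb4 : |β.2.2.2| ≤ ‖β‖ := (norm_snd_le _).trans ((norm_snd_le _).trans (norm_snd_le β))
  have e1 := (H₂ _ _ ((H₁ _ _ _ hb3 hb4).1 h hh)).of_le hk
  have e2 := ((hL.mul hL).mul (hb.of_le hk)).const_mul (-(1/2))
  refine (((DerivBound.const (β.1^2 / 2)).add e1).add e2 |>.congr fun x _ => ?_).mono ?_
  · simp only [forcing, swirlSource]; ring
  · have hk2 : (2:ℝ)^k ≤ 2^2 := pow_le_pow_right₀ (by norm_num) hk
    have hk4 : (2:ℝ)^k * 2^k ≤ 2^2 * 2^2 := mul_le_mul hk2 hk2 (by positivity) (by positivity)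
    have : β.1^2 ≤ ‖β‖^2 := sq_le_sq.2 (by rwa [abs_norm])
    have h5 := mul_le_mul_of_nonneg_right hk4 (by positivity : 0 ≤ L^2 * b)
    rw [abs_of_nonneg (by positivity : 0 ≤ β.1^2/2), abs_neg,
      abs_of_nonneg (by norm_num : (0:ℝ) ≤ 1/2)]
    have : 0 ≤ C₂ * C₁ * L^2 := by positivity
    have : 0 ≤ ‖β‖^2 * b := by positivity
    have : 0 ≤ L^2 * b := by positivity
    nlinarith [sq_nonneg ‖β‖, sq_nonneg L]

/-- The fixed point satisfies the linearized equation with nonlinear forcing. -/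
theorem hasDerivAt_of_fixed (hU : IsBackground U s) {β : ℝ × ℝ × ℝ × ℝ} {h : ℝ → ℝ}
    (hN : ContinuousOn (forcing U β h) (Ioo (-1:ℝ) 1))
    (hfix : EqOn (perturbMap U β h) h (Ioo (-1:ℝ) 1)) {x : ℝ} (hx : x ∈ Ioo (-1:ℝ) 1) :
    HasDerivAt h (-((2 * x + U x) / (1 - x^2) * h x) + (β.2.1 + forcing U β h x)) x := by
  have hd := (((hU.hasDerivAt_V1F hx).const_mul β.1).add
    ((hU.hasDerivAt_V2F hx).const_mul β.2.1)).add (hU.hasDerivAt_linSolve hN hx)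
  refine (hd.congr_of_eventuallyEq
    (hfix.symm.eventuallyEq_of_mem (isOpen_Ioo.mem_nhds hx))).congr_deriv ?_
  rw [← hfix hx, perturbMap]
  ring

theorem fixed_zero {β : ℝ × ℝ × ℝ × ℝ} {h : ℝ → ℝ}
    (hfix : EqOn (perturbMap U β h) h (Ioo (-1:ℝ) 1)) : h 0 = β.1 := by
  rw [← hfix zero_mem_Ioo]
  simp [perturbMap, V1F, V2F, linSolve, aF]

theorem forcing_zero {β : ℝ × ℝ × ℝ × ℝ} {h : ℝ → ℝ} (h0 : h 0 = β.1) :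
    forcing U β h 0 = 0 := by
  simp only [forcing, swirlSource_zero, h0]; ring

/-- Quadratic smallness of the first three derivatives of the nonlinear part on `(-1/2, 1/2)`. -/
theorem exists_derivBound_linSolve (hU : IsBackground U s)
    (hU2 : ContDiffOn ℝ 2 U (Ioo (-1:ℝ) 1)) {C : ℝ} (hC : 0 < C) :
    ∃ D : ℝ, 0 < D ∧ ∀ (β : ℝ × ℝ × ℝ × ℝ) (h : ℝ → ℝ), C * ‖β‖ ≤ 1 →
      WeightBound (1 - s) (C * ‖β‖) h → EqOn (perturbMap U β h) h (Ioo (-1:ℝ) 1) →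
      WeightBound (-s) (C * ‖β‖^2) (forcing U β h) →
      WeightBound (1 - s) (C * ‖β‖^2) (linSolve U (forcing U β h)) →
      DerivBound 3 (D * ‖β‖^2) (linSolve U (forcing U β h)) := by
  have hs := hU.pos
  have hs1 := hU.lt_one
  obtain ⟨a, ha⟩ := DerivBound.exists_of_contDiffOn (n := 2)
    (f := fun x => (2 * x + U x) / (1 - x^2))
    (ContDiffOn.div (ContDiffOn.add (by fun_prop) hU2) (by fun_prop)
      fun x hx => (one_sub_sq_pos hx).ne')
  obtain ⟨c₀, hc₀, H₀⟩ := DerivBound.exists_ode_bound 0 _ a (ha.of_le (by norm_num))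
  obtain ⟨c₁, hc₁, H₁⟩ := DerivBound.exists_ode_bound 1 _ a (ha.of_le (by norm_num))
  obtain ⟨c₂, hc₂, H₂⟩ := DerivBound.exists_ode_bound 2 _ a ha
  obtain ⟨E, hE, HE⟩ := hU.exists_derivBound_forcing
  set K₀ := 2 * C + 3 with hK₀
  set K₁ := 2 * C + 1 + E * (1 + (c₀ * K₀)^2) / C with hK₁
  set K₂ := 2 * C + E * (1 + (c₁ * K₁)^2) with hK₂
  have hK₀' : 0 < K₀ := by positivity
  have hK₁' : 0 < K₁ := by positivity
  have hK₂' : 0 < K₂ := by positivity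
  refine ⟨c₂ * K₂, by positivity, fun β h hβ hh hfix hN hW => ?_⟩
  have hn := norm_nonneg β
  have hb2 : |β.2.1| ≤ ‖β‖ := (norm_fst_le _).trans (norm_snd_le β)
  have hode := fun x (hx : x ∈ Ioo (-(1:ℝ)/2) (1/2)) =>
    hU.hasDerivAt_of_fixed hN.1 hfix (half_mem_Ioo hx)
  have hsq : C * ‖β‖^2 ≤ ‖β‖ := by nlinarith
  have hh1 := hh.mono hβ
  have hhalf := hh.half (by linarith)
  have r₀ : DerivBound 1 (c₀ * (K₀ * ‖β‖)) h := by
    refine H₀ h _ _ (((DerivBound.const β.2.1).add (n := 0) (hN.half (by linarith))).mono ?_)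
      (fun x hx => (hhalf x hx).trans ?_) hode
    · rw [hK₀]; nlinarith [mul_nonneg hC.le hn]
    · rw [hK₀]; nlinarith
  have r₁ : DerivBound 2 (c₁ * (K₁ * ‖β‖)) h := by
    refine H₁ h _ _ (((DerivBound.const β.2.1).add
      (HE β h 1 _ (by norm_num) hh1 r₀)).mono ?_) (fun x hx => (hhalf x hx).trans ?_) hode
    · have e1 : E * (‖β‖^2 + (c₀ * (K₀ * ‖β‖))^2)
          = E * (1 + (c₀ * K₀)^2) / C * (C * ‖β‖^2) := by field_simp
      have e2 : E * (1 + (c₀ * K₀)^2) / C * (C * ‖β‖^2) ≤ E * (1 + (c₀ * K₀)^2) / C * ‖β‖ :=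
        mul_le_mul_of_nonneg_left hsq (by positivity)
      rw [e1, hK₁]
      have : 0 ≤ C * ‖β‖ := by positivity
      linarith
    · have : 0 ≤ E * (1 + (c₀ * K₀)^2) / C * ‖β‖ := by positivity
      rw [hK₁]; linarith
  have hn2 : 0 ≤ ‖β‖^2 := by positivity
  have r₂ : DerivBound 3 (c₂ * (K₂ * ‖β‖^2)) (linSolve U (forcing U β h)) := by
    refine H₂ _ _ _ ((HE β h 2 _ le_rfl hh1 r₁).mono ?_)
      (fun x hx => (hW.half (by linarith) x hx).trans ?_)
      fun x hx => hU.hasDerivAt_linSolve hN.1 (half_mem_Ioo hx)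
    · have : 0 ≤ C * ‖β‖^2 := by positivity
      rw [hK₂]; linarith
    · have : 0 ≤ E * (1 + (c₁ * K₁)^2) * ‖β‖^2 := by positivity
      rw [hK₂]; linarith
  exact r₂.mono (le_of_eq (by ring))

end IsBackground

theorem eqOn_of_hasDerivAt_linear {f g A N P : ℝ → ℝ}
    (hP : ∀ x ∈ Ioo (-1:ℝ) 1, HasDerivAt P (A x) x)
    (hf : ∀ x ∈ Ioo (-1:ℝ) 1, HasDerivAt f (-(A x * f x) + N x) x)
    (hg : ∀ x ∈ Ioo (-1:ℝ) 1, HasDerivAt g (-(A x * g x) + N x) x) (h0 : f 0 = g 0) :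
    EqOn f g (Ioo (-1:ℝ) 1) := by
  have hd : ∀ x ∈ Ioo (-1:ℝ) 1, HasDerivAt (fun y => Real.exp (P y) * (f y - g y)) 0 x :=
    fun x hx => ((hP x hx).exp.mul ((hf x hx).sub (hg x hx))).congr_deriv
      (by simp only [Pi.sub_apply]; ring)
  intro x hx
  have h := isOpen_Ioo.eqOn_of_deriv_eq (isPreconnected_Ioo (a := (-1:ℝ)) (b := 1))
    (f := fun y => Real.exp (P y) * (f y - g y)) (g := fun _ => 0)
    (fun y hy => (hd y hy).differentiableAt.differentiableWithinAt) (differentiableOn_const _)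
    (fun y hy => by simp [(hd y hy).deriv]) zero_mem_Ioo (by simp [h0]) hx
  simpa [(Real.exp_pos _).ne', sub_eq_zero] using h

theorem WeightBound.rpow_mul_le {σ τ K : ℝ} {f : ℝ → ℝ} (hf : WeightBound σ K f) (h : 0 ≤ τ + σ)
    {x : ℝ} (hx : x ∈ Ioo (-1:ℝ) 1) : (1 - x^2) ^ τ * |f x| ≤ K := by
  have hp := one_sub_sq_pos hx
  calc (1 - x^2) ^ τ * |f x| ≤ (1 - x^2) ^ τ * (K * (1 - x^2) ^ σ) :=
        mul_le_mul_of_nonneg_left (hf.2 x hx) (Real.rpow_nonneg hp.le _)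
    _ = K * (1 - x^2) ^ (τ + σ) := by rw [Real.rpow_add hp]; ring
    _ ≤ K * 1 := mul_le_mul_of_nonneg_left
        (Real.rpow_le_one hp.le (by nlinarith [sq_nonneg x]) h) hf.nonneg
    _ = K := mul_one K

theorem WeightBound.of_rpow_mul_le {σ K : ℝ} {f : ℝ → ℝ} (hc : ContinuousOn f (Ioo (-1:ℝ) 1))
    (hf : ∀ x ∈ Ioo (-1:ℝ) 1, (1 - x^2) ^ (-σ) * |f x| ≤ K) : WeightBound σ K f := by
  refine ⟨hc, fun x hx => ?_⟩
  have hp := one_sub_sq_pos hx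
  have h := mul_le_mul_of_nonneg_right (hf x hx) (Real.rpow_nonneg hp.le σ)
  have e : (1 - x^2) ^ (-σ) * (1 - x^2) ^ σ = 1 := by rw [← Real.rpow_add hp]; simp
  calc |f x| = (1 - x^2) ^ (-σ) * |f x| * (1 - x^2) ^ σ := by linear_combination -|f x| * e
    _ ≤ _ := h

/-- The profile equation for the perturbed profile, given that of the background. -/
theorem profile_identity {U h : ℝ → ℝ} {β : ℝ × ℝ × ℝ × ℝ} {c₁ c₂ c₃ u' x : ℝ}
    (hx : x ∈ Ioo (-1:ℝ) 1)
    (hODE : (1 - x^2) * u' + 2 * x * U x + U x^2 / 2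
      = c₁ * (1 - x) + c₂ * (1 + x) + c₃ * (1 - x^2)) :
    (1 - x^2) * (u' + (-((2 * x + U x) / (1 - x^2) * h x) + (β.2.1 + forcing U β h x)))
        + 2 * x * (U x + h x) + (U x + h x)^2 / 2
        + swirlInt (swirlDensity U β.2.2.1 β.2.2.2 h) x
      = (c₁ + swirlInt (swirlDensity U β.2.2.1 β.2.2.2 h) (-1) / 2) * (1 - x)
        + (c₂ + swirlInt (swirlDensity U β.2.2.1 β.2.2.2 h) 1 / 2) * (1 + x)
        + (c₃ + β.2.1 + β.1^2 / 2 - (swirlInt (swirlDensity U β.2.2.1 β.2.2.2 h) (-1)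
          + swirlInt (swirlDensity U β.2.2.1 β.2.2.2 h) 1) / 2) * (1 - x^2) := by
  have hp := (one_sub_sq_pos hx).ne'
  have e1 : (1 - x^2) * ((2 * x + U x) / (1 - x^2) * h x) = (2 * x + U x) * h x := by
    field_simp
  have e2 : (1 - x^2) * forcing U β h x = (1 - x^2) * (β.1^2 / 2)
      + (swirlInt (swirlDensity U β.2.2.1 β.2.2.2 h) (-1) * (1 - x) / 2
        + swirlInt (swirlDensity U β.2.2.1 β.2.2.2 h) 1 * (1 + x) / 2
        - swirlInt (swirlDensity U β.2.2.1 β.2.2.2 h) x)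
      - (1 - x^2) * ((swirlInt (swirlDensity U β.2.2.1 β.2.2.2 h) (-1)
        + swirlInt (swirlDensity U β.2.2.1 β.2.2.2 h) 1) / 2) - 1 / 2 * (h x * h x) := by
    simp only [forcing, swirlSource]
    field_simp
    ring
  linear_combination hODE - e1 + e2

namespace IsBackground

variable {U : ℝ → ℝ} {s : ℝ}

theorem exists_weightBound (hU : IsBackground U s) : ∃ M, WeightBound 0 M U := by
  obtain ⟨M, hM⟩ := isCompact_Icc.exists_bound_of_continuousOn hU.cont
  exact ⟨M, hU.contIoo, fun x hx => by simpa using hM x (Ioo_subset_Icc_self hx)⟩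

theorem swirlSlope_zero (x : ℝ) : swirlSlope U (fun _ => 0) x = Real.exp (-(bF U x)) := by
  simp [swirlSlope]

/-- The difference of the swirl slopes for `U + h` and `U`, and its derivatives. -/
theorem hasDerivAt_swirlSlope_sub (hU : IsBackground U s) {h : ℝ → ℝ} (c : ℝ)
    (hh : ContinuousOn h (Ioo (-1:ℝ) 1)) {x : ℝ} (hx : x ∈ Ioo (-1:ℝ) 1) :
    HasDerivAt (fun y => c * (swirlSlope U h y - Real.exp (-(bF U y))))
      (-c * ((U x * (swirlSlope U h x - Real.exp (-(bF U x))) + h x * swirlSlope U h x)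
        / (1 - x^2))) x :=
  (((hU.hasDerivAt_swirlSlope hh hx).sub (hU.hasDerivAt_bF hx).neg.exp).const_mul c).congr_deriv
    (by simp only [Pi.neg_apply]; ring)

theorem hasDerivAt_V3F (hU : IsBackground U s) {x : ℝ} (hx : x ∈ Ioo (-1:ℝ) 1) :
    HasDerivAt (V3F U) (Real.exp (-(bF U x))) x :=
  hasDerivAt_primitive
    (fun _ hy => (hU.hasDerivAt_bF hy).neg.exp.continuousAt.continuousWithinAt) hx

theorem hasDerivAt_swirl_sub (hU : IsBackground U s) {h : ℝ → ℝ} (c d : ℝ)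
    (hh : ContinuousOn h (Ioo (-1:ℝ) 1)) {x : ℝ} (hx : x ∈ Ioo (-1:ℝ) 1) :
    HasDerivAt (fun y => swirl U c d h y - (c * V3F U y + d))
      (c * (swirlSlope U h x - Real.exp (-(bF U x)))) x :=
  ((hU.hasDerivAt_swirl c d hh hx).sub (((hU.hasDerivAt_V3F hx).const_mul c).add_const d)).congr_deriv
    (by ring)

theorem exists_swirl_sub_bound (hU : IsBackground U s) :
    ∃ C : ℝ, 0 < C ∧ ∀ (c d κ : ℝ) (h : ℝ → ℝ), κ ≤ 1 → WeightBound (1 - s) κ h →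
      WeightBound 0 (C * (|c| * κ)) (fun y => swirl U c d h y - (c * V3F U y + d)) ∧
      WeightBound (-s) (C * (|c| * κ)) (fun y => c * (swirlSlope U h y - Real.exp (-(bF U y)))) ∧
      WeightBound (-s - 1) (C * (|c| * κ)) (fun x => -c *
        ((U x * (swirlSlope U h x - Real.exp (-(bF U x))) + h x * swirlSlope U h x)
          / (1 - x^2))) := by
  have hs := hU.pos
  have hs1 := hU.lt_one
  obtain ⟨C, hC, H₁, H₂⟩ := hU.exists_swirlSlope_bound
  obtain ⟨M, hM⟩ := hU.exists_weightBound
  have hM0 := hM.nonneg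
  have hi : 0 < (1 - s)⁻¹ := inv_pos.2 (by linarith)
  refine ⟨C + C * (1 - s)⁻¹ + C * (M + 1), by positivity, fun c d κ h hκ hh => ?_⟩
  have hκ0 := hh.nonneg
  have hcκ : 0 ≤ |c| * κ := by positivity
  have h0 : WeightBound (1 - s) 1 (fun _ => (0:ℝ)) := ⟨continuousOn_const, fun x hx => by
    simpa using Real.rpow_nonneg (one_sub_sq_pos hx).le _⟩
  have hd : WeightBound (-s) (C * κ) (fun y => swirlSlope U h y - Real.exp (-(bF U y))) := by
    simpa only [swirlSlope_zero] using H₂ h (fun _ => 0) κ (hh.mono hκ) h0 (by simpa using hh)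
  have hcd := hd.const_mul c
  have i1 : 0 ≤ C * (|c| * κ) := by positivity
  have i2 : 0 ≤ C * (1 - s)⁻¹ * (|c| * κ) := by positivity
  have i3 : 0 ≤ C * (M + 1) * (|c| * κ) := by positivity
  refine ⟨(((hcd.primitive hs.le hs1).congr fun x hx => ?_).mono ?_), hcd.mono ?_, ?_⟩
  · refine eqOn_of_hasDerivAt_linear (P := fun _ => 0) (A := fun _ => 0)
      (N := fun x => c * (swirlSlope U h x - Real.exp (-(bF U x))))
      (fun y _ => hasDerivAt_const y 0)
      (fun y hy => (hU.hasDerivAt_swirl_sub c d hh.1 hy).congr_deriv (by ring))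
      (fun y hy => (hasDerivAt_primitive hcd.1 hy).congr_deriv (by ring)) ?_ hx
    simp [swirl, V3F]
  · nlinarith
  · nlinarith
  · have hm := (hM.mul hd).weaken (τ := -s) (by linarith)
    have hm2 := (hh.mul (H₁ h (hh.mono hκ))).weaken (τ := -s) (by linarith)
    refine ((hm.add hm2).div.const_mul (-c)).mono ?_
    rw [abs_neg]; nlinarith

end IsBackground

theorem swirlSlope_congr {U h₁ h₂ : ℝ → ℝ} (h : EqOn h₁ h₂ (Ioo (-1:ℝ) 1)) :
    EqOn (swirlSlope U h₁) (swirlSlope U h₂) (Ioo (-1:ℝ) 1) := by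
  intro x hx
  have : ∫ t in (0:ℝ)..x, h₁ t / (1 - t^2) = ∫ t in (0:ℝ)..x, h₂ t / (1 - t^2) :=
    intervalIntegral.integral_congr fun t ht => by
      simp only [h (uIcc_zero_subset_Ioo hx ht)]
  simp only [swirlSlope, this]

theorem swirl_congr {U h₁ h₂ : ℝ → ℝ} (c d : ℝ) (h : EqOn h₁ h₂ (Ioo (-1:ℝ) 1)) :
    EqOn (swirl U c d h₁) (swirl U c d h₂) (Ioo (-1:ℝ) 1) := by
  intro x hx
  have : ∫ t in (0:ℝ)..x, swirlSlope U h₁ t = ∫ t in (0:ℝ)..x, swirlSlope U h₂ t :=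
    intervalIntegral.integral_congr fun t ht =>
      swirlSlope_congr h (uIcc_zero_subset_Ioo hx ht)
  simp only [swirl, this]

namespace IsBackground

variable {U : ℝ → ℝ} {s : ℝ}

/-- The swirl equation determines the swirl component from its value and slope at the origin. -/
theorem eqOn_swirl_of_solution (hU : IsBackground U s) {h Φ D D' : ℝ → ℝ}
    (hh : ContinuousOn h (Ioo (-1:ℝ) 1))
    (hΦ : ∀ x ∈ Ioo (-1:ℝ) 1, HasDerivAt Φ (D x) x)
    (hD : ∀ x ∈ Ioo (-1:ℝ) 1, HasDerivAt D (D' x) x)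
    (heq : ∀ x ∈ Ioo (-1:ℝ) 1, (1 - x^2) * D' x + (U x + h x) * D x = 0) :
    EqOn D (fun x => D 0 * swirlSlope U h x) (Ioo (-1:ℝ) 1) ∧
      EqOn Φ (swirl U (D 0) (Φ 0) h) (Ioo (-1:ℝ) 1) := by
  have hslope : EqOn D (fun x => D 0 * swirlSlope U h x) (Ioo (-1:ℝ) 1) := by
    refine eqOn_of_hasDerivAt_linear (A := fun x => (U x + h x) / (1 - x^2)) (N := fun _ => 0)
      (P := fun x => bF U x + ∫ t in (0:ℝ)..x, h t / (1 - t^2)) ?_ ?_ ?_ ?_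
    · exact fun x hx => ((hU.hasDerivAt_bF hx).add
        (hasDerivAt_primitive (continuousOn_div_one_sub_sq hh) hx)).congr_deriv (by ring)
    · intro x hx
      refine (hD x hx).congr_deriv ?_
      have := one_sub_sq_pos hx
      field_simp
      linear_combination heq x hx
    · exact fun x hx => ((hU.hasDerivAt_swirlSlope hh hx).const_mul (D 0)).congr_deriv (by ring)
    · simp [swirlSlope, bF]
  refine ⟨hslope, eqOn_of_hasDerivAt_linear (A := fun _ => 0) (P := fun _ => 0)
    (N := fun x => D 0 * swirlSlope U h x) (fun x _ => hasDerivAt_const x 0) ?_ ?_ ?_⟩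
  · exact fun x hx => (hΦ x hx).congr_deriv (by rw [hslope hx]; ring)
  · exact fun x hx => (hU.hasDerivAt_swirl (D 0) (Φ 0) hh hx).congr_deriv (by ring)
  · simp [swirl]

/-- A small solution of the perturbation equation is a fixed point, for the parameters read off
from its values at the origin. -/
theorem fixed_of_solution (hU : IsBackground U s) {h h' : ℝ → ℝ} {c d d₁ d₂ d₃ : ℝ}
    (hd : ∀ x ∈ Ioo (-1:ℝ) 1, HasDerivAt h (h' x) x) (hb : WeightBound (1 - s) 1 h)
    (hb' : ∀ x ∈ Ioo (-1:ℝ) 1, (1 - x^2) ^ s * |h' x| ≤ 1)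
    (heq : ∀ x ∈ Ioo (-1:ℝ) 1, (1 - x^2) * h' x + (2 * x + U x) * h x + h x^2 / 2
      + swirlInt (swirlDensity U c d h) x = d₁ * (1 - x) + d₂ * (1 + x) + d₃ * (1 - x^2)) :
    EqOn (perturbMap U (h 0, h' 0 + U 0 * h 0, c, d) h) h (Ioo (-1:ℝ) 1) := by
  have hs := hU.pos
  have hs1 := hU.lt_one
  set I := swirlInt (swirlDensity U c d h) with hI
  obtain ⟨C₁, hC₁, H₁⟩ := hU.exists_swirlDensity_bound
  obtain ⟨C₂, hC₂, H₂⟩ := exists_swirlSource_bound hs hs1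
  have hF := (H₁ c d (max |c| |d|) (le_max_left _ _) (le_max_right _ _)).1 h hb
  obtain ⟨-, -, hlip, -, -⟩ := H₂ _ _ hF
  obtain ⟨M, hM⟩ := hU.exists_weightBound
  have hIcont : ContinuousOn I (Icc (-1:ℝ) 1) := by
    refine LipschitzOnWith.continuousOn (K := Real.toNNReal (C₂ * (C₁ * (max |c| |d|)^2)))
      (LipschitzOnWith.of_dist_le_mul fun x hx y hy => ?_)
    rw [Real.dist_eq, Real.dist_eq, Real.coe_toNNReal _ (by positivity)]
    exact hlip x hx y hy
  have hid : WeightBound 0 2 (fun x : ℝ => 2 * x) := ⟨by fun_prop, fun x hx => by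
    rw [abs_le, Real.rpow_zero]; constructor <;> linarith [hx.1, hx.2]⟩
  have hlow : WeightBound (1 - s) ((2 + M) * 1 + |1/2| * (1 * 1))
      (fun x => (2 * x + U x) * h x + 1 / 2 * (h x * h x)) :=
    (((hid.add hM).mul hb).weaken (by linarith)).add
      (((hb.mul hb).weaken (by linarith)).const_mul (1/2))
  set Q := (2 + M) * 1 + |1/2| * (1 * 1)
  have hle := le_on_closure (s := Ioo (-1:ℝ) 1)
    (f := fun x => |d₁ * (1 - x) + d₂ * (1 + x) + d₃ * (1 - x^2) - I x|)
    (g := fun x => (1 + Q) * (1 - x^2) ^ (1 - s)) (fun x hx => ?_)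
    (by
      rw [closure_Ioo (by norm_num)]
      exact (ContinuousOn.sub (by fun_prop) hIcont).abs)
    (Continuous.continuousOn (continuous_const.mul
      (Continuous.rpow_const (by fun_prop) fun _ => Or.inr (by linarith))))
  swap
  · have hp := one_sub_sq_pos hx
    have e1 : |(1 - x^2) * h' x| ≤ (1 - x^2) ^ (1 - s) := by
      rw [abs_mul, abs_of_pos hp]
      have e : (1 - x^2) ^ (1 - s) * (1 - x^2) ^ s = 1 - x^2 := by
        rw [← Real.rpow_add hp]; simp
      calc (1 - x^2) * |h' x| = (1 - x^2) ^ (1 - s) * ((1 - x^2) ^ s * |h' x|) := by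
            linear_combination -|h' x| * e
        _ ≤ (1 - x^2) ^ (1 - s) * 1 :=
            mul_le_mul_of_nonneg_left (hb' x hx) (Real.rpow_nonneg hp.le _)
        _ = _ := mul_one _
    have e2 := hlow.2 x hx
    calc |d₁ * (1 - x) + d₂ * (1 + x) + d₃ * (1 - x^2) - I x|
        = |(1 - x^2) * h' x + ((2 * x + U x) * h x + 1 / 2 * (h x * h x))| := by
          congr 1; linear_combination -heq x hx
      _ ≤ _ := abs_add_le _ _
      _ ≤ _ := by linarith
  rw [closure_Ioo (by norm_num)] at hle
  have h0s : (0:ℝ) ^ (1 - s) = 0 := Real.zero_rpow (by linarith)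
  have hl : I (-1) = 2 * d₁ := by
    have := hle (x := -1) (by norm_num)
    norm_num [h0s] at this
    linarith
  have hr : I 1 = 2 * d₂ := by
    have := hle (x := 1) (by norm_num)
    norm_num [h0s] at this
    linarith
  have h00 : h' 0 + U 0 * h 0 + h 0^2 / 2 = d₁ + d₂ + d₃ := by
    have := heq 0 zero_mem_Ioo
    have hI0 : I 0 = 0 := by simp [hI, swirlInt]
    rw [hI0] at this
    linarith
  set β : ℝ × ℝ × ℝ × ℝ := (h 0, h' 0 + U 0 * h 0, c, d) with hβ
  obtain ⟨C, hC, HN⟩ := hU.exists_forcing_bound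
  have hN := ((HN β).1 h 1 le_rfl hb).1
  refine eqOn_of_hasDerivAt_linear (N := fun x => β.2.1 + forcing U β h x)
    (fun x hx => hU.hasDerivAt_aF hx) ?_ ?_ ?_
  · intro x hx
    exact ((((hU.hasDerivAt_V1F hx).const_mul β.1).add
      ((hU.hasDerivAt_V2F hx).const_mul β.2.1)).add (hU.hasDerivAt_linSolve hN hx)).congr_deriv
        (by rw [perturbMap]; ring)
  · intro x hx
    refine (hd x hx).congr_deriv ?_
    have hp := (one_sub_sq_pos hx).ne'
    have hx' := heq x hx
    simp only [forcing, swirlSource, hβ]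
    rw [← hI, hl, hr]
    field_simp
    linear_combination 2 * hx' - 2 * (1 - x^2) * h00
  · simp [perturbMap, V1F, V2F, linSolve, aF, hβ]

/-- The family of small solutions together with the estimates of the corrections. -/
theorem exists_correction (hU : IsBackground U s) (hU2 : ContDiffOn ℝ 2 U (Ioo (-1:ℝ) 1)) :
    ∃ C r δ : ℝ, 0 < C ∧ 0 < r ∧ r ≤ 1 ∧ 0 < δ ∧ ∀ β : ℝ × ℝ × ℝ × ℝ, ‖β‖ < δ → ∃ h,
      ContinuousOn h (Ioo (-1:ℝ) 1) ∧ ContinuousOn (forcing U β h) (Ioo (-1:ℝ) 1) ∧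
      EqOn (perturbMap U β h) h (Ioo (-1:ℝ) 1) ∧
      (∀ h₁, WeightBound (1 - s) r h₁ → EqOn (perturbMap U β h₁) h₁ (Ioo (-1:ℝ) 1) →
        EqOn h₁ h (Ioo (-1:ℝ) 1)) ∧
      WeightBound (1 - s) (C * ‖β‖^2) (linSolve U (forcing U β h)) ∧
      WeightBound (-s) (C * ‖β‖^2) (fun x =>
        -((2 * x + U x) / (1 - x^2) * linSolve U (forcing U β h) x) + forcing U β h x) ∧
      DerivBound 3 (C * ‖β‖^2) (linSolve U (forcing U β h)) ∧
      WeightBound 0 (C * ‖β‖^2)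
        (fun y => swirl U β.2.2.1 β.2.2.2 h y - (β.2.2.1 * V3F U y + β.2.2.2)) ∧
      WeightBound (-s) (C * ‖β‖^2)
        (fun y => β.2.2.1 * (swirlSlope U h y - Real.exp (-(bF U y)))) ∧
      WeightBound (-s - 1) (C * ‖β‖^2) (fun x => -β.2.2.1 *
        ((U x * (swirlSlope U h x - Real.exp (-(bF U x))) + h x * swirlSlope U h x)
          / (1 - x^2))) := by
  have hs := hU.pos
  have hs1 := hU.lt_one
  obtain ⟨C, r, δ, hC, hr, hr1, hδ, H⟩ := hU.exists_perturbation
  obtain ⟨D, hD, HD⟩ := hU.exists_derivBound_linSolve hU2 hC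
  obtain ⟨E, hE, HE⟩ := hU.exists_swirl_sub_bound
  obtain ⟨M, hM⟩ := hU.exists_weightBound
  have hM0 := hM.nonneg
  refine ⟨C + (2 + M) * C + D + E * C, r, δ, by positivity, hr, hr1, hδ, fun β hβ => ?_⟩
  obtain ⟨hCβ, ⟨h, hhr, hh, hfix, hN, hL⟩, huniq⟩ := H β hβ
  have hn2 : 0 ≤ ‖β‖^2 := by positivity
  have i1 : 0 ≤ C * ‖β‖^2 := by positivity
  have i2 : 0 ≤ (2 + M) * C * ‖β‖^2 := by positivity
  have i3 : 0 ≤ D * ‖β‖^2 := by positivity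
  have i4 : 0 ≤ E * C * ‖β‖^2 := by positivity
  have hb3 : |β.2.2.1| ≤ ‖β‖ := (norm_fst_le _).trans ((norm_snd_le _).trans (norm_snd_le β))
  have hswirl : E * (|β.2.2.1| * (C * ‖β‖)) ≤ (C + (2 + M) * C + D + E * C) * ‖β‖^2 := by
    have := mul_le_mul_of_nonneg_right hb3 (by positivity : 0 ≤ E * C * ‖β‖)
    nlinarith
  obtain ⟨z1, z2, z3⟩ := HE β.2.2.1 β.2.2.2 _ h hCβ hh
  have hid : WeightBound 0 2 (fun x : ℝ => 2 * x) := ⟨by fun_prop, fun x hx => by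
    rw [abs_le, Real.rpow_zero]; constructor <;> linarith [hx.1, hx.2]⟩
  refine ⟨h, hh.1, hN.1, hfix, fun h₁ hb hf => huniq h₁ h hb hhr hf hfix, hL.mono ?_, ?_,
    (HD β h hCβ hh hfix hN hL).mono ?_, z1.mono hswirl, z2.mono hswirl, z3.mono hswirl⟩
  · linarith
  · refine (((((hid.add hM).mul hL).div.weaken (by linarith)).neg.add hN).congr
      fun x _ => ?_).mono ?_
    · ring
    · linarith
  · linarith

end IsBackground

/-- existence, smallness and local uniqueness of the four-parameter family
of solutions `U = Ū + β₁V¹ + β₂V² + β₃V³ + β₄V⁴ + Ũ(β)` of the profile system for the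
axisymmetric stationary Navier–Stokes equations near a no-swirl solution `Ū` with
`Ū(−1) < 2` and `Ū(1) > −2`. -/
theorem stmt19 (c₁ c₂ c₃ γ α C₀ ε : ℝ)
    (Ub Ub' : ℝ → ℝ)
    (hc : ContinuousOn Ub (Icc (-1:ℝ) 1))
    (hC2 : ContDiffOn ℝ 2 Ub (Ioo (-1:ℝ) 1))
    (hd : ∀ x ∈ Ioo (-1:ℝ) 1, HasDerivAt Ub (Ub' x) x)
    (hODE : ∀ x ∈ Ioo (-1:ℝ) 1,
      (1-x^2) * Ub' x + 2*x * Ub x + Ub x^2 / 2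
        = c₁*(1-x) + c₂*(1+x) + c₃*(1-x^2))
    (h0 : Ub 0 = γ)
    (hum : Ub (-1) < 2) (hup : -2 < Ub 1)
    (hα : 0 < α) (hα1 : α ≤ 1) (hC₀ : 0 < C₀)
    (hm : ∀ x ∈ Ioc (-1:ℝ) 0, |Ub x - Ub (-1)| ≤ C₀ * (1+x) ^ α)
    (hp : ∀ x ∈ Ico (0:ℝ) 1, |Ub x - Ub 1| ≤ C₀ * (1-x) ^ α)
    (hε1 : 0 < ε) (hε2 : ε < 1/2)
    (hε3 : Ub (-1) < 4*ε) (hε4 : -(Ub 1) < 4*ε) :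
    ∃ δ > 0, ∃ δ' > 0,
    ∃ (W W' W'' W''' Z Z' Z'' : (ℝ × ℝ × ℝ × ℝ) → ℝ → ℝ)
      (m : (ℝ × ℝ × ℝ × ℝ) → ℝ),
      -- regularity, vanishing functionals at 0 and norm control of the correction Ũ(β)
      (∀ β : ℝ × ℝ × ℝ × ℝ, ‖β‖ < δ →
        (∀ x ∈ Ioo (-1:ℝ) 1, HasDerivAt (W β) (W' β x) x) ∧
        (∀ x ∈ Ioo (-(1:ℝ)/2) (1/2), HasDerivAt (W' β) (W'' β x) x) ∧
        (∀ x ∈ Ioo (-(1:ℝ)/2) (1/2), HasDerivAt (W'' β) (W''' β x) x) ∧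
        (∀ x ∈ Ioo (-1:ℝ) 1, HasDerivAt (Z β) (Z' β x) x) ∧
        (∀ x ∈ Ioo (-1:ℝ) 1, HasDerivAt (Z' β) (Z'' β x) x) ∧
        W β 0 = 0 ∧ W' β 0 = 0 ∧ Z β 0 = 0 ∧ Z' β 0 = 0 ∧
        (∀ x ∈ Ioo (-1:ℝ) 1,
          (1-x^2) ^ (-1+2*ε) * |W β x| ≤ m β ∧
          (1-x^2) ^ (2*ε) * |W' β x| ≤ m β) ∧
        (∀ x ∈ Ioo (-(1:ℝ)/2) (1/2), |W'' β x| ≤ m β ∧ |W''' β x| ≤ m β) ∧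
        (∀ x ∈ Ioo (-1:ℝ) 1,
          (1-x^2) ^ ε * |Z β x| ≤ m β ∧
          (1-x^2) ^ (1+ε) * |Z' β x| ≤ m β ∧
          (1-x^2) ^ (2+ε) * |Z'' β x| ≤ m β)) ∧
      -- (i): Ũ(0) = 0 and the norm of Ũ(β) is o(|β|) as β → 0
      (∀ x : ℝ, W 0 x = 0 ∧ Z 0 x = 0) ∧
      Tendsto (fun β : ℝ × ℝ × ℝ × ℝ => m β / ‖β‖)
        (nhdsWithin 0 {(0 : ℝ × ℝ × ℝ × ℝ)}ᶜ) (nhds 0) ∧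
      -- (ii): for each |β| < δ, U(β) solves the profile system for some e₁, e₂, e₃
      (∀ β : ℝ × ℝ × ℝ × ℝ, ‖β‖ < δ →
        ∃ e₁ e₂ e₃ : ℝ, ∃ Dθ Dφ Dφ2 : ℝ → ℝ,
          (let Θ : ℝ → ℝ := fun y =>
            Ub y + β.1 * V1F Ub y + β.2.1 * V2F Ub y + W β y
           let Φ : ℝ → ℝ := fun y => β.2.2.1 * V3F Ub y + β.2.2.2 + Z β y
           ∀ x ∈ Ioo (-1:ℝ) 1,
             HasDerivAt Θ (Dθ x) x ∧ HasDerivAt Φ (Dφ x) x ∧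
             HasDerivAt Dφ (Dφ2 x) x ∧
             ((1-x^2) * Dθ x + 2*x * Θ x + Θ x^2 / 2
                + (∫ l in (0:ℝ)..x, ∫ t in (0:ℝ)..l, ∫ s in (0:ℝ)..t,
                    2 * Φ s * Dφ s / (1-s^2))
                = e₁*(1-x) + e₂*(1+x) + e₃*(1-x^2)) ∧
             ((1-x^2) * Dφ2 x + Θ x * Dφ x = 0))) ∧
      -- (iii): local uniqueness
      (∀ (Vθ VθD Vφ VφD VφDD D2 D3 : ℝ → ℝ) (e₁ e₂ e₃ m' : ℝ),
        (∀ x ∈ Ioo (-1:ℝ) 1, HasDerivAt Vθ (VθD x) x) →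
        (∀ x ∈ Ioo (-1:ℝ) 1, HasDerivAt Vφ (VφD x) x) →
        (∀ x ∈ Ioo (-1:ℝ) 1, HasDerivAt VφD (VφDD x) x) →
        (∀ x ∈ Ioo (-(1:ℝ)/2) (1/2),
          HasDerivAt (fun y => VθD y - Ub' y) (D2 x) x) →
        (∀ x ∈ Ioo (-(1:ℝ)/2) (1/2), HasDerivAt D2 (D3 x) x) →
        (∀ x ∈ Ioo (-1:ℝ) 1,
          (1-x^2) * VθD x + 2*x * Vθ x + Vθ x^2 / 2
            + (∫ l in (0:ℝ)..x, ∫ t in (0:ℝ)..l, ∫ s in (0:ℝ)..t,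
                2 * Vφ s * VφD s / (1-s^2))
            = e₁*(1-x) + e₂*(1+x) + e₃*(1-x^2)) →
        (∀ x ∈ Ioo (-1:ℝ) 1, (1-x^2) * VφDD x + Vθ x * VφD x = 0) →
        m' < δ' →
        (∀ x ∈ Ioo (-1:ℝ) 1,
          (1-x^2) ^ (-1+2*ε) * |Vθ x - Ub x| ≤ m' ∧
          (1-x^2) ^ (2*ε) * |VθD x - Ub' x| ≤ m') →
        (∀ x ∈ Ioo (-(1:ℝ)/2) (1/2), |D2 x| ≤ m' ∧ |D3 x| ≤ m') →
        (∀ x ∈ Ioo (-1:ℝ) 1,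
          (1-x^2) ^ ε * |Vφ x| ≤ m' ∧ (1-x^2) ^ (1+ε) * |VφD x| ≤ m' ∧
            (1-x^2) ^ (2+ε) * |VφDD x| ≤ m') →
        ∃ β : ℝ × ℝ × ℝ × ℝ, ‖β‖ < δ ∧
          ∀ x ∈ Ioo (-1:ℝ) 1,
            Vθ x = Ub x + β.1 * V1F Ub x + β.2.1 * V2F Ub x + W β x ∧
            Vφ x = β.2.2.1 * V3F Ub x + β.2.2.2 + Z β x) := by
  have hU : IsBackground Ub (2 * ε) :=
    ⟨hc, by linarith, by linarith, by linarith, by linarith⟩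
  obtain ⟨C, r, δ, hC, hr, hr1, hδ, H⟩ := hU.exists_correction hC2
  choose! h hcont hN hfix huniq hW hW' hW3 hZ hZ' hZ'' using H
  set L : (ℝ × ℝ × ℝ × ℝ) → ℝ → ℝ := fun β => linSolve Ub (forcing Ub β (h β)) with hL
  set W : (ℝ × ℝ × ℝ × ℝ) → ℝ → ℝ := fun β => indicator (Ioo (-1:ℝ) 1) (L β)
  set Z : (ℝ × ℝ × ℝ × ℝ) → ℝ → ℝ := fun β y =>
    swirl Ub β.2.2.1 β.2.2.2 (h β) y - (β.2.2.1 * V3F Ub y + β.2.2.2) with hZdef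
  set M := 1 + |Ub 0| with hM
  have hM0 : 0 < M := by positivity
  have hWL : ∀ β, EqOn (W β) (L β) (Ioo (-1:ℝ) 1) := fun β x hx => indicator_of_mem hx _
  have hWd : ∀ β, ‖β‖ < δ → ∀ x ∈ Ioo (-1:ℝ) 1, HasDerivAt (W β)
      (-((2 * x + Ub x) / (1 - x^2) * L β x) + forcing Ub β (h β) x) x := fun β hβ x hx =>
    (hU.hasDerivAt_linSolve (hN β hβ) hx).congr_of_eventuallyEq
      ((hWL β).eventuallyEq_of_mem (isOpen_Ioo.mem_nhds hx))
  have hsplit : ∀ β, ‖β‖ < δ → ∀ x ∈ Ioo (-1:ℝ) 1,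
      Ub x + β.1 * V1F Ub x + β.2.1 * V2F Ub x + W β x = Ub x + h β x := by
    intro β hβ x hx
    rw [hWL β hx, ← hfix β hβ hx, perturbMap]
    ring
  refine ⟨δ, hδ, min r (δ / M), by positivity, W, fun β => deriv (W β),
    fun β => deriv (deriv (W β)), fun β => deriv (deriv (deriv (W β))), Z,
    fun β y => β.2.2.1 * (swirlSlope Ub (h β) y - Real.exp (-(bF Ub y))),
    fun β x => -β.2.2.1 * ((Ub x * (swirlSlope Ub (h β) x - Real.exp (-(bF Ub x)))
      + h β x * swirlSlope Ub (h β) x) / (1 - x^2)),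
    fun β => C * ‖β‖^2, ?_, ?_, ?_, ?_, ?_⟩
  · intro β hβ
    have hW3' : DerivBound 3 (C * ‖β‖^2) (W β) :=
      (hW3 β hβ).congr fun x hx => hWL β (half_mem_Ioo hx)
    refine ⟨fun x hx => (hWd β hβ x hx).differentiableAt.hasDerivAt,
      fun x hx => (hW3'.2.1 x hx).2.hasDerivAt, fun x hx => (hW3'.2.2.1 x hx).2.hasDerivAt,
      fun x hx => hU.hasDerivAt_swirl_sub _ _ (hcont β hβ) hx,
      fun x hx => hU.hasDerivAt_swirlSlope_sub _ (hcont β hβ) hx, ?_, ?_, ?_, ?_,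
      fun x hx => ⟨?_, ?_⟩, fun x hx => ⟨(hW3'.2.2.1 x hx).1, hW3'.2.2.2 x hx⟩,
      fun x hx => ⟨?_, ?_, ?_⟩⟩
    · rw [hWL β zero_mem_Ioo]; simp [hL, linSolve]
    · beta_reduce
      rw [(hWd β hβ 0 zero_mem_Ioo).deriv,
        IsBackground.forcing_zero (IsBackground.fixed_zero (hfix β hβ))]
      simp [hL, linSolve]
    · simp [hZdef, swirl, V3F]
    · simp [swirlSlope, bF]
    · rw [hWL β hx]
      exact (hW β hβ).rpow_mul_le (by linarith) hx
    · beta_reduce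
      rw [(hWd β hβ x hx).deriv]
      exact (hW' β hβ).rpow_mul_le (by linarith) hx
    · exact (hZ β hβ).rpow_mul_le (by linarith) hx
    · exact (hZ' β hβ).rpow_mul_le (by linarith) hx
    · exact (hZ'' β hβ).rpow_mul_le (by linarith) hx
  · intro x
    refine ⟨?_, by simp [hZdef, swirl]⟩
    by_cases hx : x ∈ Ioo (-1:ℝ) 1
    · have := (hW 0 (by simpa using hδ)).2 x hx
      rw [hWL 0 hx]
      simpa using this
    · exact indicator_of_notMem hx _
  · have hlim : Tendsto (fun β : ℝ × ℝ × ℝ × ℝ => C * ‖β‖) (nhds 0) (nhds 0) := by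
      have : Continuous fun β : ℝ × ℝ × ℝ × ℝ => C * ‖β‖ := by fun_prop
      simpa using this.tendsto 0
    refine (hlim.mono_left nhdsWithin_le_nhds).congr' ?_
    filter_upwards [self_mem_nhdsWithin] with β hβ
    have : ‖β‖ ≠ 0 := norm_ne_zero_iff.2 hβ
    field_simp
  · intro β hβ
    have hΦ : (fun y => β.2.2.1 * V3F Ub y + β.2.2.2 + Z β y)
        = swirl Ub β.2.2.1 β.2.2.2 (h β) := by
      funext y; simp only [hZdef]; ring
    set D : ℝ → ℝ := swirlDensity Ub β.2.2.1 β.2.2.2 (h β)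
    refine ⟨c₁ + swirlInt D (-1) / 2, c₂ + swirlInt D 1 / 2,
      c₃ + β.2.1 + β.1^2 / 2 - (swirlInt D (-1) + swirlInt D 1) / 2,
      fun x => Ub' x + (-((2 * x + Ub x) / (1 - x^2) * h β x)
        + (β.2.1 + forcing Ub β (h β) x)), fun x => β.2.2.1 * swirlSlope Ub (h β) x,
      fun x => β.2.2.1 * -((Ub x + h β x) / (1 - x^2) * swirlSlope Ub (h β) x), ?_⟩
    intro Θ Φ x hx
    have hΦ' : Φ = swirl Ub β.2.2.1 β.2.2.2 (h β) := hΦ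
    have hΘ : EqOn Θ (fun y => Ub y + h β y) (Ioo (-1:ℝ) 1) := hsplit β hβ
    rw [hΦ', hΘ hx]
    refine ⟨?_, hU.hasDerivAt_swirl _ _ (hcont β hβ) hx,
      (hU.hasDerivAt_swirlSlope (hcont β hβ) hx).const_mul _,
      profile_identity hx (hODE x hx), ?_⟩
    · exact ((hd x hx).add (hU.hasDerivAt_of_fixed (hN β hβ) (hfix β hβ) hx)).congr_of_eventuallyEq
        (hΘ.eventuallyEq_of_mem (isOpen_Ioo.mem_nhds hx))
    · have := (one_sub_sq_pos hx).ne'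
      field_simp
      ring
  · intro Vθ VθD Vφ VφD VφDD D2 D3 e₁ e₂ e₃ m' hVθ hVφ hVφD _ _ hprof hswirl hm' hM1 _ hM2
    set g : ℝ → ℝ := fun x => Vθ x - Ub x with hg
    have hgd : ∀ x ∈ Ioo (-1:ℝ) 1, HasDerivAt g (VθD x - Ub' x) x := fun x hx =>
      (hVθ x hx).sub (hd x hx)
    have hgc : ContinuousOn g (Ioo (-1:ℝ) 1) := fun x hx =>
      (hgd x hx).continuousAt.continuousWithinAt
    have hm'r : m' ≤ r := hm'.le.trans (min_le_left _ _)
    have hgb : WeightBound (1 - 2 * ε) m' g := WeightBound.of_rpow_mul_le hgc fun x hx => by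
      rw [show -(1 - 2 * ε) = -1 + 2 * ε by ring]; exact (hM1 x hx).1
    have hm0 := hgb.nonneg
    obtain ⟨hslope, hval⟩ := hU.eqOn_swirl_of_solution hgc hVφ hVφD fun x hx => by
      have := hswirl x hx
      simp only [hg]
      linear_combination this
    have hfixg := hU.fixed_of_solution (c := VφD 0) (d := Vφ 0) (d₁ := e₁ - c₁) (d₂ := e₂ - c₂)
      (d₃ := e₃ - c₃) hgd (hgb.mono (hm'r.trans hr1))
      (fun x hx => (hM1 x hx).2.trans (hm'r.trans hr1)) fun x hx => by
        have e : swirlInt (swirlDensity Ub (VφD 0) (Vφ 0) g) x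
            = swirlInt (fun y => 2 * Vφ y * VφD y) x :=
          swirlInt_congr (fun y hy => by rw [swirlDensity, hval hy, hslope hy]) hx
        have e' : swirlInt (fun y => 2 * Vφ y * VφD y) x = ∫ l in (0:ℝ)..x, ∫ t in (0:ℝ)..l,
            ∫ s in (0:ℝ)..t, 2 * Vφ s * VφD s / (1-s^2) := rfl
        rw [e, e']
        simp only [hg]
        linear_combination hprof x hx - hODE x hx
    set β : ℝ × ℝ × ℝ × ℝ := (g 0, VθD 0 - Ub' 0 + Ub 0 * g 0, VφD 0, Vφ 0) with hβdef
    have hβ : ‖β‖ < δ := by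
      have hlt : M * m' < δ := by
        have := hm'.trans_le (min_le_right _ _)
        rwa [lt_div_iff₀ hM0, mul_comm] at this
      have hm'M : m' ≤ M * m' := by
        rw [hM]; nlinarith [mul_nonneg (abs_nonneg (Ub 0)) hm0]
      have b1 := (hM1 0 zero_mem_Ioo).1
      have b2 := (hM1 0 zero_mem_Ioo).2
      obtain ⟨b4, b3, -⟩ := hM2 0 zero_mem_Ioo
      norm_num at b1 b2 b3 b4
      refine lt_of_le_of_lt ?_ hlt
      simp only [hβdef, norm_prod_le_iff, Real.norm_eq_abs]
      refine ⟨b1.trans hm'M, ?_, b3.trans hm'M, b4.trans hm'M⟩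
      calc |VθD 0 - Ub' 0 + Ub 0 * g 0| ≤ |VθD 0 - Ub' 0| + |Ub 0| * |g 0| := by
            rw [← abs_mul]; exact abs_add_le _ _
        _ ≤ m' + |Ub 0| * m' := add_le_add b2 (mul_le_mul_of_nonneg_left b1 (abs_nonneg _))
        _ = M * m' := by rw [hM]; ring
    have heq : EqOn g (h β) (Ioo (-1:ℝ) 1) := huniq β hβ g (hgb.mono hm'r) hfixg
    refine ⟨β, hβ, fun x hx => ⟨?_, ?_⟩⟩
    · rw [hsplit β hβ x hx, ← heq hx]; simp only [hg]; ring
    · rw [hval hx, swirl_congr _ _ heq hx]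
      simp only [hZdef, hβdef]
      ring
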